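/- arXiv:2311.08939 — 4 statements merged into one kernel-verified Lean document; each statement's English description precedes it below -/
import Mathlib

section
/- The sequence (r_n^forw)^{1/n} converges to 6^{1/4} as n → ∞. -/
open scoped Classical

/-- Full plane binary trees with leaves labeled by natural numbers
(representing the variables `X_i`). -/
inductive BTree : Type where
  | leaf : ℕ → BTree
  | node : BTree → BTree → BTree

namespace BTree

/-- The list of leaf labels, from left to right. -/
def leaves : BTree → List ℕ
  | leaf a => [a]
  | node l r => l.leaves ++ r.leaves

/-- The expansion set `W(T, ℓ)` of the commutator monomial modeled by `T`. -/
def words : BTree → Finset (List ℕ)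
  | leaf a => {[a]}
  | node l r =>
      ((l.words ×ˢ r.words).image fun p => p.1 ++ p.2) ∪
      ((l.words ×ˢ r.words).image fun p => p.2 ++ p.1)

end BTree

/-- A word (list of labels) is alternating: consecutive entries differ, and no entry
lies strictly between its two neighbours. -/
def IsAlternating (w : List ℕ) : Prop :=
  (∀ i, i + 1 < w.length → w.getD i 0 ≠ w.getD (i + 1) 0) ∧
  (∀ i, i + 2 < w.length →
    ¬ (w.getD i 0 < w.getD (i + 1) 0 ∧ w.getD (i + 1) 0 < w.getD (i + 2) 0) ∧
    ¬ (w.getD (i + 2) 0 < w.getD (i + 1) 0 ∧ w.getD (i + 1) 0 < w.getD i 0))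

/-- A word is forward alternating: alternating, and it does not start with an ascent. -/
def IsForwardAlternating (w : List ℕ) : Prop :=
  IsAlternating w ∧ (w.length ≤ 1 ∨ w.getD 1 0 < w.getD 0 0)

/-- Number of alternating words in the expansion of `t`. -/
noncomputable def altCount (t : BTree) : ℕ :=
  (t.words.filter fun w => IsAlternating w).card

/-- Number of forward alternating words in the expansion of `t`. -/
noncomputable def faltCount (t : BTree) : ℕ :=
  (t.words.filter fun w => IsForwardAlternating w).card

/-- `rAlt n` : the maximal number of alternating associative monomials in a commutator
monomial whose leaves are labeled bijectively by `{1, …, n}`. -/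
noncomputable def rAlt (n : ℕ) : ℕ :=
  sSup {m | ∃ t : BTree, t.leaves.Perm (List.range' 1 n) ∧ m = altCount t}

/-- `rFAlt n` : the forward-alternating analogue of `rAlt n`. -/
noncomputable def rFAlt (n : ℕ) : ℕ :=
  sSup {m | ∃ t : BTree, t.leaves.Perm (List.range' 1 n) ∧ m = faltCount t}

/-- The number of alternating permutations of `{1, …, n}` (denoted `Ẽ_n`). -/
noncomputable def altPerms (n : ℕ) : ℕ :=
  Nat.card {σ : Equiv.Perm (Fin n) // IsAlternating (List.ofFn fun i => (σ i : ℕ))}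

/-- The number of forward alternating permutations of `{1, …, n}` (denoted `E_n`). -/
noncomputable def faltPerms (n : ℕ) : ℕ :=
  Nat.card {σ : Equiv.Perm (Fin n) // IsForwardAlternating (List.ofFn fun i => (σ i : ℕ))}

section Domination

variable {X Y : Type*}

/-- A nonnegative function, monotone for `r`, whose sum over each multiset `m` with `A m w`
is at most `w * μ`. -/
structure IsTest (r : X → X → Prop) (A : Multiset X → ℝ → Prop) (c : X → ℝ) (μ : ℝ) : Prop where
  nonneg : ∀ x, 0 ≤ c x
  mono : ∀ x y, r x y → c x ≤ c y
  atom_le : ∀ m w, A m w → (m.map c).sum ≤ w * μ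

/-- Every test function with constant `μ` sums over `m` to at most `q * μ`. -/
def Dominated (r : X → X → Prop) (A : Multiset X → ℝ → Prop) (m : Multiset X) (q : ℝ) : Prop :=
  ∀ c μ, IsTest r A c μ → (m.map c).sum ≤ q * μ

theorem Dominated.tensor {r : X → X → Prop} {A : Multiset X → ℝ → Prop} {m : Multiset X} {q : ℝ}
    {r' : Y → Y → Prop} {A' : Multiset Y → ℝ → Prop} {m' : Multiset Y} {q' : ℝ}
    (h : Dominated r A m q) (h' : Dominated r' A' m' q') (κ : X → Y → ℝ) (μ : ℝ)
    (nonneg : ∀ x y, 0 ≤ κ x y) (mono : ∀ x x' y, r x x' → κ x y ≤ κ x' y)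
    (mono' : ∀ x y y', r' y y' → κ x y ≤ κ x y')
    (atom_le : ∀ a w a' w', A a w → A' a' w' →
      (a.map fun x => (a'.map fun y => κ x y).sum).sum ≤ w * w' * μ) :
    (m.map fun x => (m'.map fun y => κ x y).sum).sum ≤ q * q' * μ := by
  rw [mul_assoc]
  refine h _ _ ⟨fun x => Multiset.sum_nonneg ?_, fun x x' hx => Multiset.sum_map_le_sum_map _ _
    fun y _ => mono x x' y hx, fun a w ha => ?_⟩
  · simp only [Multiset.mem_map]
    rintro _ ⟨y, -, rfl⟩
    exact nonneg x y
  · rw [Multiset.sum_map_sum_map]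
    have := h' (fun y => (a.map fun x => κ x y).sum) (w * μ) ⟨fun y => Multiset.sum_nonneg ?_,
      fun y y' hy => Multiset.sum_map_le_sum_map _ _ fun x _ => mono' x y y' hy,
      fun a' w' ha' => ?_⟩
    · linarith
    · simp only [Multiset.mem_map]
      rintro _ ⟨x, -, rfl⟩
      exact nonneg x y
    · rw [Multiset.sum_map_sum_map]
      linarith [atom_le a w a' w' ha ha']

end Domination

theorem ite_zero_mono {p q : Prop} [Decidable p] [Decidable q] {a b : ℝ} (hpq : p → q)
    (hab : a ≤ b) (hb : 0 ≤ b) : (if p then a else 0) ≤ if q then b else 0 := by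
  split_ifs with h1 h2 h2
  · exact hab
  · exact absurd (hpq h1) h2
  · exact hb
  · exact le_rfl

theorem ite_zero_le {p : Prop} [Decidable p] {a b : ℝ} (hab : a ≤ b) (hb : 0 ≤ b) :
    (if p then a else 0) ≤ b := by
  split_ifs <;> assumption

theorem ite_zero_le_self (p : Prop) [Decidable p] (a : ℝ) (ha : 0 ≤ a) :
    (if p then a else 0) ≤ a := ite_zero_le le_rfl ha

theorem ite_zero_nonneg {p : Prop} [Decidable p] {a : ℝ} (ha : 0 ≤ a) :
    0 ≤ if p then a else 0 := by
  split_ifs <;> simp [ha]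

section Atoms

variable {L : Type*} [LinearOrder L]

/-- `M` if `x < y`, and `0` otherwise. -/
noncomputable def gate (M : ℝ) (x y : L) : ℝ := if x < y then M else 0

theorem gate_le {M : ℝ} (hM : 0 ≤ M) (x y : L) : gate M x y ≤ M := ite_zero_le le_rfl hM

theorem gate_add_gate_le {M : ℝ} (hM : 0 ≤ M) {x y x' y' : L} (h : y ≤ x') (h' : y' ≤ x) :
    gate M x y + gate M x' y' ≤ M := by
  unfold gate
  split_ifs with h1 h2
  · exact absurd (h1.trans_le (h.trans (h2.le.trans h'))) (lt_irrefl _)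
  all_goals linarith

variable [BoundedOrder L]

/-- The order on pairs (first letter, last letter) under which a word of even length
starting with a descent becomes easier to extend. -/
def EvenRel (x y : L × L) : Prop := x.1 ≤ y.1 ∧ y.2 ≤ x.2

/-- Weighted configurations of ends that test functions are required to bound. -/
inductive EvenAtom : Multiset (L × L) → ℝ → Prop
  | cherry : EvenAtom {(⊤, ⊥)} √6
  | low (a b : L) (h : a ≤ b) : EvenAtom {(b, a), (a, b), (b, ⊥)} 6
  | high (a b : L) (h : a ≤ b) : EvenAtom {(b, a), (a, b), (⊤, a)} 6
  | fork (w : L) : EvenAtom {(⊤, w), (w, ⊥)} 4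

/-- The analogue of `EvenRel` for words of odd length, the tag recording whether the word starts
(and ends) with a peak. -/
def OddRel : Bool × L × L → Bool × L × L → Prop
  | (true, x, y), (true, x', y') => x ≤ x' ∧ y ≤ y'
  | (false, x, y), (false, x', y') => x' ≤ x ∧ y' ≤ y
  | _, _ => False

/-- The analogue of `EvenAtom` for words of odd length. -/
inductive OddAtom : Multiset (Bool × L × L) → ℝ → Prop
  | leaf (x y : L) :
      OddAtom {(true, x, y), (true, y, x), (false, x, y), (false, y, x)} 2
  | tripod (z : L) :
      OddAtom {(true, ⊤, z), (true, z, ⊤), (false, ⊥, z), (false, z, ⊥)} √6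
  | free : OddAtom {(true, ⊤, ⊤), (false, ⊥, ⊥)} (2 * √6 / 3)

/-- `IsTest EvenRel EvenAtom`, spelled out. -/
structure EvenTest (c : L × L → ℝ) (μ : ℝ) : Prop where
  nonneg : ∀ s e, 0 ≤ c (s, e)
  mono : ∀ {s s' e e'}, s ≤ s' → e' ≤ e → c (s, e) ≤ c (s', e')
  cherry : c (⊤, ⊥) ≤ √6 * μ
  low : ∀ {a b}, a ≤ b → c (b, a) + c (a, b) + c (b, ⊥) ≤ 6 * μ
  high : ∀ {a b}, a ≤ b → c (b, a) + c (a, b) + c (⊤, a) ≤ 6 * μ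
  fork : ∀ w, c (⊤, w) + c (w, ⊥) ≤ 4 * μ

theorem IsTest.even {c : L × L → ℝ} {μ : ℝ} (h : IsTest EvenRel EvenAtom c μ) : EvenTest c μ where
  nonneg s e := h.nonneg _
  mono h1 h2 := h.mono _ _ ⟨h1, h2⟩
  cherry := by simpa using h.atom_le _ _ .cherry
  low {a b} hab := by simpa [add_assoc] using h.atom_le _ _ (.low a b hab)
  high {a b} hab := by simpa [add_assoc] using h.atom_le _ _ (.high a b hab)
  fork w := by simpa using h.atom_le _ _ (.fork w)

/-- `IsTest OddRel OddAtom`, spelled out. -/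
structure OddTest (c : Bool × L × L → ℝ) (ν : ℝ) : Prop where
  nonneg : ∀ b x y, 0 ≤ c (b, x, y)
  mono_true : ∀ {x x' y y'}, x ≤ x' → y ≤ y' → c (true, x, y) ≤ c (true, x', y')
  mono_false : ∀ {x x' y y'}, x' ≤ x → y' ≤ y → c (false, x, y) ≤ c (false, x', y')
  leaf : ∀ x y, c (true, x, y) + c (true, y, x) + c (false, x, y) + c (false, y, x) ≤ 2 * ν
  tripod : ∀ z, c (true, ⊤, z) + c (true, z, ⊤) + c (false, ⊥, z) + c (false, z, ⊥) ≤ √6 * ν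
  free : c (true, ⊤, ⊤) + c (false, ⊥, ⊥) ≤ 2 * √6 / 3 * ν

theorem IsTest.odd {c : Bool × L × L → ℝ} {ν : ℝ} (h : IsTest OddRel OddAtom c ν) :
    OddTest c ν where
  nonneg b x y := h.nonneg _
  mono_true h1 h2 := h.mono _ _ ⟨h1, h2⟩
  mono_false h1 h2 := h.mono _ _ ⟨h1, h2⟩
  leaf x y := by simpa [add_assoc] using h.atom_le _ _ (.leaf x y)
  tripod z := by simpa [add_assoc] using h.atom_le _ _ (.tripod z)
  free := by simpa using h.atom_le _ _ .free

theorem sqrt_six_bounds {μ : ℝ} (hμ : 0 ≤ μ) :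
    2.449 * μ ≤ √6 * μ ∧ √6 * μ ≤ 2.45 * μ ∧ √6 ^ 2 * μ = 6 * μ ∧
      √6 ^ 3 * μ = 6 * (√6 * μ) := by
  have h := Real.sq_sqrt (show (0 : ℝ) ≤ 6 by norm_num)
  refine ⟨mul_le_mul_of_nonneg_right (Real.le_sqrt_of_sq_le (by norm_num)) hμ,
    mul_le_mul_of_nonneg_right ((Real.sqrt_le_left (by norm_num)).2 (by norm_num)) hμ,
    by rw [h], by rw [pow_succ, h]; ring⟩

/-- Contribution to a node of a pair of words with ends `x` and `y`, both of even length. -/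
def evenEvenKernel (c : L × L → ℝ) (x y : L × L) : ℝ :=
  (if x.2 < y.1 then c (x.1, y.2) else 0) + (if y.2 < x.1 then c (y.1, x.2) else 0)

theorem evenEvenKernel_comm {L : Type*} [LinearOrder L] (c : L × L → ℝ) (x y : L × L) :
    evenEvenKernel c x y = evenEvenKernel c y x := add_comm _ _

theorem EvenTest.mu_nonneg {c : L × L → ℝ} {μ : ℝ} (h : EvenTest c μ) : 0 ≤ μ := by
  have := h.fork ⊤
  linarith [h.nonneg ⊤ ⊤, h.nonneg ⊤ ⊥]

theorem EvenTest.le_top_bot {c : L × L → ℝ} {μ : ℝ} (h : EvenTest c μ) (s e : L) :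
    c (s, e) ≤ c (⊤, ⊥) := h.mono le_top bot_le

theorem evenEven_cherry {c : L × L → ℝ} {μ : ℝ} (h : EvenTest c μ) {a : Multiset (L × L)} {w : ℝ}
    (ha : EvenAtom a w) :
    (a.map fun x => evenEvenKernel c (⊤, ⊥) x).sum ≤ w * √6 * μ := by
  obtain ⟨h1, h2, h3, -⟩ := sqrt_six_bounds h.mu_nonneg
  have hM := h.nonneg ⊤ ⊥
  have hc := h.cherry
  have key : ∀ x : L × L, evenEvenKernel c (⊤, ⊥) x ≤ 2 * c (⊤, ⊥) := fun x => by
    have := ite_zero_le (p := ⊥ < x.1) (h.le_top_bot ⊤ x.2) hM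
    have := ite_zero_le (p := x.2 < ⊤) (h.le_top_bot x.1 ⊥) hM
    simp only [evenEvenKernel]
    linarith
  cases ha with
  | cherry =>
    simp only [Multiset.map_singleton, Multiset.sum_singleton]
    linarith [key (⊤, ⊥)]
  | low a b hab =>
    simp only [Multiset.insert_eq_cons, Multiset.map_cons, Multiset.sum_cons,
      Multiset.map_singleton, Multiset.sum_singleton]
    linarith [key (b, a), key (a, b), key (b, ⊥)]
  | high a b hab =>
    simp only [Multiset.insert_eq_cons, Multiset.map_cons, Multiset.sum_cons,
      Multiset.map_singleton, Multiset.sum_singleton]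
    linarith [key (b, a), key (a, b), key (⊤, a)]
  | fork w =>
    simp only [Multiset.insert_eq_cons, Multiset.map_cons, Multiset.sum_cons,
      Multiset.map_singleton, Multiset.sum_singleton]
    linarith [key (⊤, w), key (w, ⊥)]

theorem EvenTest.kernel_le {c : L × L → ℝ} {μ : ℝ} (h : EvenTest c μ) (s e s' e' : L) :
    evenEvenKernel c (s, e) (s', e') ≤ gate (c (⊤, ⊥)) e s' + gate (c (⊤, ⊥)) e' s :=
  add_le_add (ite_zero_mono id (h.le_top_bot _ _) (h.nonneg _ _))
    (ite_zero_mono id (h.le_top_bot _ _) (h.nonneg _ _))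

theorem EvenTest.kernel_le' {c : L × L → ℝ} {μ : ℝ} (h : EvenTest c μ) (s e s' e' : L) :
    evenEvenKernel c (s, e) (s', e') ≤ c (s, e') + c (s', e) :=
  add_le_add (ite_zero_le le_rfl (h.nonneg _ _)) (ite_zero_le le_rfl (h.nonneg _ _))

theorem evenEven_low_low {c : L × L → ℝ} {μ : ℝ} (h : EvenTest c μ) {a b a' b' : L}
    (hab : a ≤ b) (hab' : a' ≤ b') :
    (Multiset.map (fun x => (Multiset.map (fun y => evenEvenKernel c x y)
      {(b', a'), (a', b'), (b', ⊥)}).sum) {(b, a), (a, b), (b, ⊥)}).sum ≤ 36 * μ := by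
  obtain ⟨h1, h2, -, -⟩ := sqrt_six_bounds h.mu_nonneg
  have hM := h.nonneg ⊤ ⊥
  have hc := h.cherry
  have gl := gate_le (L := L) hM
  simp only [Multiset.insert_eq_cons, Multiset.map_cons, Multiset.sum_cons,
    Multiset.map_singleton, Multiset.sum_singleton]
  linarith [h.kernel_le b a b' a', h.kernel_le b a a' b', h.kernel_le b a b' ⊥,
    h.kernel_le a b b' a', h.kernel_le a b a' b', h.kernel_le a b b' ⊥,
    h.kernel_le b ⊥ b' a', h.kernel_le b ⊥ a' b', h.kernel_le b ⊥ b' ⊥,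
    gate_add_gate_le hM (le_refl b') (le_refl b), gate_add_gate_le hM (le_refl a') (le_refl a),
    gate_add_gate_le hM hab' hab, gl a b', gl a' b, gl ⊥ a, gl ⊥ b, gl ⊥ a', gl ⊥ b']

theorem evenEven_high_high {c : L × L → ℝ} {μ : ℝ} (h : EvenTest c μ) {a b a' b' : L}
    (hab : a ≤ b) (hab' : a' ≤ b') :
    (Multiset.map (fun x => (Multiset.map (fun y => evenEvenKernel c x y)
      {(b', a'), (a', b'), (⊤, a')}).sum) {(b, a), (a, b), (⊤, a)}).sum ≤ 36 * μ := by
  obtain ⟨h1, h2, -, -⟩ := sqrt_six_bounds h.mu_nonneg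
  have hM := h.nonneg ⊤ ⊥
  have hc := h.cherry
  have gl := gate_le (L := L) hM
  simp only [Multiset.insert_eq_cons, Multiset.map_cons, Multiset.sum_cons,
    Multiset.map_singleton, Multiset.sum_singleton]
  linarith [h.kernel_le b a b' a', h.kernel_le b a a' b', h.kernel_le b a ⊤ a',
    h.kernel_le a b b' a', h.kernel_le a b a' b', h.kernel_le a b ⊤ a',
    h.kernel_le ⊤ a b' a', h.kernel_le ⊤ a a' b', h.kernel_le ⊤ a ⊤ a',
    gate_add_gate_le hM (le_refl b') (le_refl b), gate_add_gate_le hM (le_refl a') (le_refl a),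
    gate_add_gate_le hM hab' hab, gl a b', gl a' b, gl a ⊤, gl b ⊤, gl a' ⊤, gl b' ⊤]

theorem evenEven_low_high {c : L × L → ℝ} {μ : ℝ} (h : EvenTest c μ) {a b a' b' : L} :
    (Multiset.map (fun x => (Multiset.map (fun y => evenEvenKernel c x y)
      {(b', a'), (a', b'), (⊤, a')}).sum) {(b, a), (a, b), (b, ⊥)}).sum ≤ 36 * μ := by
  obtain ⟨h1, h2, -, -⟩ := sqrt_six_bounds h.mu_nonneg
  have hM := h.nonneg ⊤ ⊥
  have hc := h.cherry
  have gl := gate_le (L := L) hM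
  simp only [Multiset.insert_eq_cons, Multiset.map_cons, Multiset.sum_cons,
    Multiset.map_singleton, Multiset.sum_singleton]
  linarith [h.kernel_le b a b' a', h.kernel_le b a a' b', h.kernel_le b a ⊤ a',
    h.kernel_le a b b' a', h.kernel_le a b a' b', h.kernel_le a b ⊤ a',
    h.kernel_le b ⊥ b' a', h.kernel_le b ⊥ a' b', h.kernel_le b ⊥ ⊤ a',
    gate_add_gate_le hM (le_refl b') (le_refl b), gate_add_gate_le hM (le_refl a') (le_refl a),
    gate_add_gate_le hM (le_refl a') (le_refl b), gate_add_gate_le hM (le_refl b') (le_refl a),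
    gl a' b, gl b' b, gl a ⊤, gl b ⊤, gl ⊥ b', gl ⊥ a', gl ⊥ ⊤, gl a' a]

theorem evenEven_low_fork {c : L × L → ℝ} {μ : ℝ} (h : EvenTest c μ) {a b w : L} :
    (Multiset.map (fun x => (Multiset.map (fun y => evenEvenKernel c x y)
      {(⊤, w), (w, ⊥)}).sum) {(b, a), (a, b), (b, ⊥)}).sum ≤ 24 * μ := by
  obtain ⟨h1, h2, -, -⟩ := sqrt_six_bounds h.mu_nonneg
  have hM := h.nonneg ⊤ ⊥
  have hc := h.cherry
  have gl := gate_le (L := L) hM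
  simp only [Multiset.insert_eq_cons, Multiset.map_cons, Multiset.sum_cons,
    Multiset.map_singleton, Multiset.sum_singleton]
  have e1 : evenEvenKernel c (b, ⊥) (⊤, w) ≤ c (b, w) + gate (c (⊤, ⊥)) w b :=
    add_le_add (ite_zero_le le_rfl (h.nonneg _ _)) (ite_zero_mono id (h.le_top_bot _ _) hM)
  have e2 : evenEvenKernel c (b, ⊥) (w, ⊥) ≤ c (⊤, ⊥) + c (w, ⊥) :=
    add_le_add (ite_zero_le (h.le_top_bot _ _) hM) (ite_zero_le le_rfl (h.nonneg _ _))
  have e3 : c (b, w) ≤ c (⊤, w) := h.mono le_top le_rfl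
  linarith [h.kernel_le b a ⊤ w, h.kernel_le b a w ⊥, h.kernel_le a b ⊤ w, h.kernel_le a b w ⊥,
    gate_add_gate_le hM (le_refl w) (le_refl b), gate_add_gate_le hM (le_refl w) (le_refl a),
    h.fork w, gl w b, gl a ⊤, gl b ⊤, gl ⊥ a, gl ⊥ b]

theorem evenEven_high_fork {c : L × L → ℝ} {μ : ℝ} (h : EvenTest c μ) {a b w : L} :
    (Multiset.map (fun x => (Multiset.map (fun y => evenEvenKernel c x y)
      {(⊤, w), (w, ⊥)}).sum) {(b, a), (a, b), (⊤, a)}).sum ≤ 24 * μ := by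
  obtain ⟨h1, h2, -, -⟩ := sqrt_six_bounds h.mu_nonneg
  have hM := h.nonneg ⊤ ⊥
  have hc := h.cherry
  have gl := gate_le (L := L) hM
  simp only [Multiset.insert_eq_cons, Multiset.map_cons, Multiset.sum_cons,
    Multiset.map_singleton, Multiset.sum_singleton]
  have e1 : evenEvenKernel c (⊤, a) (⊤, w) ≤ c (⊤, w) + c (⊤, ⊥) :=
    add_le_add (ite_zero_le le_rfl (h.nonneg _ _)) (ite_zero_le (h.le_top_bot _ _) hM)
  have e2 : evenEvenKernel c (⊤, a) (w, ⊥) ≤ gate (c (⊤, ⊥)) a w + c (w, a) :=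
    add_le_add (ite_zero_mono id (h.le_top_bot _ _) hM) (ite_zero_le le_rfl (h.nonneg _ _))
  have e3 : c (w, a) ≤ c (w, ⊥) := h.mono le_rfl bot_le
  linarith [h.kernel_le b a ⊤ w, h.kernel_le b a w ⊥, h.kernel_le a b ⊤ w, h.kernel_le a b w ⊥,
    gate_add_gate_le hM (le_refl w) (le_refl b), gate_add_gate_le hM (le_refl w) (le_refl a),
    h.fork w, gl a w, gl a ⊤, gl b ⊤, gl ⊥ a, gl ⊥ b]

theorem evenEven_fork_fork {c : L × L → ℝ} {μ : ℝ} (h : EvenTest c μ) {v w : L} :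
    (Multiset.map (fun x => (Multiset.map (fun y => evenEvenKernel c x y)
      {(⊤, w), (w, ⊥)}).sum) {(⊤, v), (v, ⊥)}).sum ≤ 16 * μ := by
  obtain ⟨h1, h2, -, -⟩ := sqrt_six_bounds h.mu_nonneg
  have hM := h.nonneg ⊤ ⊥
  have hc := h.cherry
  simp only [Multiset.insert_eq_cons, Multiset.map_cons, Multiset.sum_cons,
    Multiset.map_singleton, Multiset.sum_singleton]
  have e1 : evenEvenKernel c (⊤, v) (w, ⊥) ≤ gate (c (⊤, ⊥)) v w + c (w, v) :=
    add_le_add (ite_zero_mono id (h.le_top_bot _ _) hM) (ite_zero_le le_rfl (h.nonneg _ _))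
  have e2 : evenEvenKernel c (v, ⊥) (⊤, w) ≤ c (v, w) + gate (c (⊤, ⊥)) w v :=
    add_le_add (ite_zero_le le_rfl (h.nonneg _ _)) (ite_zero_mono id (h.le_top_bot _ _) hM)
  have e3 : c (w, v) ≤ c (w, ⊥) := h.mono le_rfl bot_le
  have e4 : c (v, w) ≤ c (⊤, w) := h.mono le_top le_rfl
  linarith [h.kernel_le' ⊤ v ⊤ w, h.kernel_le' v ⊥ w ⊥, h.fork v, h.fork w,
    gate_add_gate_le hM (le_refl w) (le_refl v)]

theorem evenEven_atoms {c : L × L → ℝ} {μ : ℝ} (h : EvenTest c μ) {a a' : Multiset (L × L)}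
    {w w' : ℝ} (ha : EvenAtom a w) (ha' : EvenAtom a' w') :
    (a.map fun x => (a'.map fun y => evenEvenKernel c x y).sum).sum ≤ w * w' * μ := by
  have swap : ∀ b b' : Multiset (L × L),
      (b.map fun x => (b'.map fun y => evenEvenKernel c x y).sum).sum =
      (b'.map fun x => (b.map fun y => evenEvenKernel c x y).sum).sum := fun b b' => by
    rw [Multiset.sum_map_sum_map]
    simp_rw [evenEvenKernel_comm c]
  cases ha with
  | cherry => simpa [mul_comm w' √6] using evenEven_cherry h ha'
  | low a b hab =>
    cases ha' with
    | cherry => rw [swap]; simpa using evenEven_cherry h (.low a b hab)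
    | low a' b' hab' => linarith [evenEven_low_low h hab hab']
    | high a' b' hab' => linarith [evenEven_low_high h (a := a) (b := b) (a' := a') (b' := b')]
    | fork w => linarith [evenEven_low_fork h (a := a) (b := b) (w := w)]
  | high a b hab =>
    cases ha' with
    | cherry => rw [swap]; simpa using evenEven_cherry h (.high a b hab)
    | low a' b' hab' =>
      rw [swap]; linarith [evenEven_low_high h (a := a') (b := b') (a' := a) (b' := b)]
    | high a' b' hab' => linarith [evenEven_high_high h hab hab']
    | fork w => linarith [evenEven_high_fork h (a := a) (b := b) (w := w)]
  | fork v =>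
    cases ha' with
    | cherry => rw [swap]; simpa using evenEven_cherry h (.fork v)
    | low a b hab => rw [swap]; linarith [evenEven_low_fork h (a := a) (b := b) (w := v)]
    | high a b hab => rw [swap]; linarith [evenEven_high_fork h (a := a) (b := b) (w := v)]
    | fork w => linarith [evenEven_fork_fork h (v := v) (w := w)]

/-- A pair of opposite monotone functions with bounds on their values and sums. -/
structure Spread (P V : L → ℝ) (A B C : ℝ) : Prop where
  nonneg_left : ∀ t, 0 ≤ P t
  nonneg_right : ∀ t, 0 ≤ V t
  monotone : Monotone P
  antitone : Antitone V
  left_le : ∀ t, P t ≤ C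
  right_le : ∀ t, V t ≤ C
  add_le : ∀ t, P t + V t ≤ A
  top_add_bot_le : P ⊤ + V ⊥ ≤ B

theorem Spread.add_le_total {P V : L → ℝ} {A B C : ℝ} (h : Spread P V A B C) (s e : L) :
    P s + V e ≤ B :=
  (add_le_add (h.monotone le_top) (h.antitone bot_le)).trans h.top_add_bot_le

theorem Spread.sum_le {P V : L → ℝ} {A B C D : ℝ} (h : Spread P V A B C)
    (hcherry : B ≤ √6 * D) (htriple : 2 * A + B ≤ 6 * D) (hfork : A + B ≤ 4 * D)
    {a : Multiset (L × L)} {w : ℝ} (ha : EvenAtom a w) :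
    (a.map fun q => P q.1 + V q.2).sum ≤ w * D := by
  cases ha with
  | cherry =>
    simp only [Multiset.map_singleton, Multiset.sum_singleton]
    linarith [h.top_add_bot_le]
  | low a b hab =>
    simp only [Multiset.insert_eq_cons, Multiset.map_cons, Multiset.sum_cons,
      Multiset.map_singleton, Multiset.sum_singleton]
    linarith [h.add_le a, h.add_le b, h.add_le_total b ⊥]
  | high a b hab =>
    simp only [Multiset.insert_eq_cons, Multiset.map_cons, Multiset.sum_cons,
      Multiset.map_singleton, Multiset.sum_singleton]
    linarith [h.add_le a, h.add_le b, h.add_le_total ⊤ a]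
  | fork w =>
    simp only [Multiset.insert_eq_cons, Multiset.map_cons, Multiset.sum_cons,
      Multiset.map_singleton, Multiset.sum_singleton]
    linarith [h.add_le w, h.top_add_bot_le]

theorem Spread.gated_sum_le {P V : L → ℝ} {A B C D : ℝ} (h : Spread P V A B C)
    (hcherry : B ≤ √6 * D) (htriple : A + 2 * C ≤ 6 * D) (hmiddle : 2 * B ≤ 6 * D)
    (hside : 3 * C ≤ 6 * D) (hfork : A + C ≤ 4 * D) (z : L)
    {a : Multiset (L × L)} {w : ℝ} (ha : EvenAtom a w) :
    (a.map fun q => (if q.2 < z then P q.1 else 0) + if z < q.1 then V q.2 else 0).sum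
      ≤ w * D := by
  have hP := h.nonneg_left
  have hV := h.nonneg_right
  cases ha with
  | cherry =>
    simp only [Multiset.map_singleton, Multiset.sum_singleton]
    linarith [h.top_add_bot_le, ite_zero_le_self (⊥ < z) _ (hP ⊤), ite_zero_le_self (z < ⊤) _ (hV ⊥)]
  | low a b hab =>
    simp only [Multiset.insert_eq_cons, Multiset.map_cons, Multiset.sum_cons,
      Multiset.map_singleton, Multiset.sum_singleton]
    have d := ite_zero_le_self (⊥ < z) _ (hP b)
    rcases le_or_gt z a with hz | hz
    · rw [if_neg hz.not_gt, if_neg (hz.trans hab).not_gt]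
      linarith [h.add_le b, h.right_le a, h.right_le ⊥, ite_zero_le_self (z < a) _ (hV b),
        ite_zero_le_self (z < b) _ (hV a), ite_zero_le_self (z < b) _ (hV ⊥)]
    · rw [if_neg hz.not_gt, if_pos hz]
      rcases lt_or_ge z b with hz' | hz'
      · rw [if_neg hz'.not_gt, if_pos hz', if_pos hz']
        linarith [h.add_le_total b a, h.add_le_total b ⊥]
      · rw [if_neg hz'.not_gt, if_neg hz'.not_gt]
        linarith [h.left_le a, h.left_le b, ite_zero_le_self (b < z) _ (hP a)]
  | high a b hab =>
    simp only [Multiset.insert_eq_cons, Multiset.map_cons, Multiset.sum_cons,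
      Multiset.map_singleton, Multiset.sum_singleton]
    have d := ite_zero_le_self (z < ⊤) _ (hV a)
    rcases le_or_gt z a with hz | hz
    · rw [if_neg hz.not_gt, if_neg (hz.trans hab).not_gt, if_neg hz.not_gt]
      linarith [h.right_le a, h.right_le b, ite_zero_le_self (z < a) _ (hV b), ite_zero_le_self (z < b) _ (hV a)]
    · rw [if_pos hz, if_neg hz.not_gt, if_pos hz]
      rcases lt_or_ge z b with hz' | hz'
      · rw [if_neg hz'.not_gt, if_pos hz']
        linarith [h.add_le_total b a, h.add_le_total ⊤ a]
      · rw [if_neg hz'.not_gt]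
        linarith [h.add_le a, h.left_le b, h.left_le ⊤, ite_zero_le_self (b < z) _ (hP a)]
  | fork w =>
    simp only [Multiset.insert_eq_cons, Multiset.map_cons, Multiset.sum_cons,
      Multiset.map_singleton, Multiset.sum_singleton]
    have d := ite_zero_le_self (⊥ < z) _ (hP w)
    have d' := ite_zero_le_self (z < ⊤) _ (hV w)
    rcases le_or_gt z w with hz | hz
    · rw [if_neg hz.not_gt]
      linarith [h.add_le w, h.right_le ⊥, ite_zero_le_self (z < w) _ (hV ⊥)]
    · rw [if_pos hz, if_neg hz.not_gt]
      linarith [h.add_le w, h.left_le ⊤]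

theorem OddTest.nu_nonneg {c : Bool × L × L → ℝ} {ν : ℝ} (h : OddTest c ν) : 0 ≤ ν := by
  linarith [h.leaf ⊤ ⊤, h.nonneg true ⊤ ⊤, h.nonneg false ⊤ ⊤]

theorem OddTest.spread {c : Bool × L × L → ℝ} {ν : ℝ} (h : OddTest c ν) (y : L) :
    Spread (fun t => c (true, t, y) + c (true, y, t)) (fun t => c (false, t, y) + c (false, y, t))
      (2 * ν) (√6 * ν) (2 * ν) where
  nonneg_left t := add_nonneg (h.nonneg _ _ _) (h.nonneg _ _ _)
  nonneg_right t := add_nonneg (h.nonneg _ _ _) (h.nonneg _ _ _)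
  monotone _ _ hst := add_le_add (h.mono_true hst le_rfl) (h.mono_true le_rfl hst)
  antitone _ _ hst := add_le_add (h.mono_false hst le_rfl) (h.mono_false le_rfl hst)
  left_le t := by linarith [h.leaf t y, h.nonneg false t y, h.nonneg false y t]
  right_le t := by linarith [h.leaf t y, h.nonneg true t y, h.nonneg true y t]
  add_le t := by linarith [h.leaf t y]
  top_add_bot_le := by linarith [h.tripod y]

theorem OddTest.spread_extreme {c : Bool × L × L → ℝ} {ν : ℝ} (h : OddTest c ν) :
    Spread (fun t => c (true, t, ⊤) + c (true, ⊤, t)) (fun t => c (false, t, ⊥) + c (false, ⊥, t))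
      (√6 * ν) (4 * √6 / 3 * ν) (2 * ν) where
  nonneg_left t := add_nonneg (h.nonneg _ _ _) (h.nonneg _ _ _)
  nonneg_right t := add_nonneg (h.nonneg _ _ _) (h.nonneg _ _ _)
  monotone := (h.spread ⊤).monotone
  antitone := (h.spread ⊥).antitone
  left_le := (h.spread ⊤).left_le
  right_le := (h.spread ⊥).right_le
  add_le t := by linarith [h.tripod t]
  top_add_bot_le := by linarith [h.free]

/-- Contribution to a node of a pair of words of odd and even length. -/
noncomputable def oddEvenKernel (c : Bool × L × L → ℝ) : Bool × L × L → L × L → ℝ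
  | (true, x, y), (s, e) =>
    (if e < x then c (true, s, y) else 0) + if e < y then c (true, x, s) else 0
  | (false, x, y), (s, e) =>
    (if x < s then c (false, e, y) else 0) + if y < s then c (false, x, e) else 0

theorem sum_map_le_of_le_add {α : Type*} (a : Multiset α) {F G H : α → ℝ} {g h : ℝ}
    (le : ∀ x, F x ≤ G x + H x) (hG : (a.map G).sum ≤ g) (hH : (a.map H).sum ≤ h) :
    (a.map F).sum ≤ g + h := by
  refine (Multiset.sum_map_le_sum_map _ _ fun x _ => le x).trans ?_
  rw [Multiset.sum_map_add]
  exact add_le_add hG hH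

theorem oddEven_atoms {c : Bool × L × L → ℝ} {ν : ℝ} (h : OddTest c ν)
    {a : Multiset (Bool × L × L)} {a' : Multiset (L × L)}
    {w w' : ℝ} (ha : OddAtom a w) (ha' : EvenAtom a' w') :
    (a.map fun x => (a'.map fun y => oddEvenKernel c x y).sum).sum ≤ w * w' * ν := by
  obtain ⟨h1, h2, h3, -⟩ := sqrt_six_bounds h.nu_nonneg
  have hν := h.nu_nonneg
  rw [Multiset.sum_map_sum_map]
  have hw' : 0 ≤ w' := by cases ha' <;> positivity
  cases ha with
  | leaf x y =>
    have bound : ∀ x y, _ := fun x y => (h.spread y).gated_sum_le (D := ν) le_rfl (by linarith)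
      (by linarith) (by linarith) (by linarith) x ha'
    refine (sum_map_le_of_le_add _ (fun q => ?_) (bound x y) (bound y x)).trans (by linarith)
    simp only [Multiset.insert_eq_cons, Multiset.map_cons, Multiset.sum_cons,
      Multiset.map_singleton, Multiset.sum_singleton, oddEvenKernel]
    split_ifs <;> linarith
  | tripod z =>
    refine (sum_map_le_of_le_add _ (fun q => ?_)
      ((h.spread z).sum_le (D := 1.1125 * ν) (by linarith) (by linarith) (by linarith) ha')
      (h.spread_extreme.gated_sum_le (D := 4 / 3 * ν) (by linarith) (by linarith)
      (by linarith) (by linarith) (by linarith) z ha')).trans ?_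
    · simp only [Multiset.insert_eq_cons, Multiset.map_cons, Multiset.sum_cons,
        Multiset.map_singleton, Multiset.sum_singleton, oddEvenKernel]
      have := ite_zero_le_self (q.2 < ⊤) _ (h.nonneg true q.1 z)
      have := ite_zero_le_self (q.2 < ⊤) _ (h.nonneg true z q.1)
      have := ite_zero_le_self (⊥ < q.1) _ (h.nonneg false q.2 z)
      have := ite_zero_le_self (⊥ < q.1) _ (h.nonneg false z q.2)
      by_cases hz : q.2 < z <;> by_cases hz' : z < q.1 <;> simp only [hz, hz', if_true, if_false] <;>
        linarith
    · nlinarith [mul_le_mul_of_nonneg_left h1 hw']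
  | free =>
    refine (Multiset.sum_map_le_sum_map _ _ fun q _ => ?_).trans
      ((h.spread_extreme.sum_le (D := 2 * √6 / 3 * ν) (by linarith) (by linarith)
        (by linarith) ha').trans (by linarith))
    simp only [Multiset.insert_eq_cons, Multiset.map_cons, Multiset.sum_cons,
      Multiset.map_singleton, Multiset.sum_singleton, oddEvenKernel]
    linarith [ite_zero_le_self (q.2 < ⊤) _ (h.nonneg true q.1 ⊤), ite_zero_le_self (q.2 < ⊤) _ (h.nonneg true ⊤ q.1),
      ite_zero_le_self (⊥ < q.1) _ (h.nonneg false q.2 ⊥), ite_zero_le_self (⊥ < q.1) _ (h.nonneg false ⊥ q.2)]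

/-- Contribution to a node of a pair of words of odd length. -/
def oddOddKernel (c : L × L → ℝ) : Bool × L × L → Bool × L × L → ℝ
  | (true, x, y), (false, x', y') => if x' < y then c (x, y') else 0
  | (false, x', y'), (true, x, y) => if x' < y then c (x, y') else 0
  | _, _ => 0

theorem oddOddKernel_comm {L : Type*} [LinearOrder L] (c : L × L → ℝ) (x y : Bool × L × L) :
    oddOddKernel c x y = oddOddKernel c y x := by
  obtain ⟨_ | _, x⟩ := x <;> obtain ⟨_ | _, y⟩ := y <;> rfl

theorem EvenTest.ite_le_gate {c : L × L → ℝ} {μ : ℝ} (h : EvenTest c μ) (x y s e : L) :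
    (if x < y then c (s, e) else 0) ≤ gate (c (⊤, ⊥)) x y :=
  ite_zero_mono id (h.le_top_bot s e) (h.nonneg _ _)

theorem EvenTest.ite_le {c : L × L → ℝ} {μ : ℝ} (h : EvenTest c μ) (x y s e : L) :
    (if x < y then c (s, e) else 0) ≤ c (s, e) := ite_zero_le_self _ _ (h.nonneg s e)

theorem EvenTest.low' {c : L × L → ℝ} {μ : ℝ} (h : EvenTest c μ) (x z : L) :
    c (x, z) + c (z, x) + c (x, ⊥) ≤ 6 * μ := by
  rcases le_total x z with hxz | hxz
  · linarith [h.low hxz, h.mono hxz (le_refl ⊥)]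
  · exact h.low hxz

theorem EvenTest.high' {c : L × L → ℝ} {μ : ℝ} (h : EvenTest c μ) (x z : L) :
    c (x, z) + c (z, x) + c (⊤, x) ≤ 6 * μ := by
  rcases le_total x z with hxz | hxz
  · linarith [h.high hxz]
  · linarith [h.high hxz, h.mono (le_refl ⊤) hxz]

theorem EvenTest.gated {c : L × L → ℝ} {μ : ℝ} (h : EvenTest c μ) (x y z : L) :
    c (x, z) + c (z, x) + (if z < y then c (x, ⊥) else 0) + (if y < z then c (⊤, x) else 0)
      ≤ 6 * μ := by
  split_ifs with h1 h2
  · exact absurd h2 h1.not_gt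
  · linarith [h.low' x z]
  · linarith [h.high' x z]
  · linarith [h.low' x z, h.nonneg x ⊥]

theorem oddOdd_leaf {c : L × L → ℝ} {μ : ℝ} (h : EvenTest c μ) (x y : L)
    {a : Multiset (Bool × L × L)} {w : ℝ} (ha : OddAtom a w) :
    (Multiset.map (fun p => (a.map fun q => oddOddKernel c p q).sum)
      {(true, x, y), (true, y, x), (false, x, y), (false, y, x)}).sum ≤ 2 * w * (√6 * μ) := by
  obtain ⟨h1, h2, h3, -⟩ := sqrt_six_bounds h.mu_nonneg
  have hM := h.nonneg ⊤ ⊥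
  have hc := h.cherry
  cases ha with
  | leaf x' y' =>
    simp only [Multiset.insert_eq_cons, Multiset.map_cons, Multiset.sum_cons,
      Multiset.map_singleton, Multiset.sum_singleton, oddOddKernel]
    have conflict : ∀ u v s e s' e', (if u < v then c (s, e) else 0) +
        (if v < u then c (s', e') else 0) ≤ c (⊤, ⊥) := fun u v s e s' e' =>
      (add_le_add (h.ite_le_gate _ _ _ _) (h.ite_le_gate _ _ _ _)).trans
        (gate_add_gate_le hM le_rfl le_rfl)
    linarith [conflict x' y x y' x' y, conflict y' y x x' y' y, conflict x' x y y' x' x,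
      conflict y' x y x' y' x, conflict x' y x y' y' x, conflict y' y x x' x' x,
      conflict x' x y y' y' y, conflict y' x y x' x' y]
  | tripod z =>
    simp only [Multiset.insert_eq_cons, Multiset.map_cons, Multiset.sum_cons,
      Multiset.map_singleton, Multiset.sum_singleton, oddOddKernel]
    linarith [h.gated x y z, h.gated y x z, h.ite_le ⊥ y x z, h.ite_le ⊥ x y z,
      h.ite_le x ⊤ z y, h.ite_le y ⊤ z x]
  | free =>
    simp only [Multiset.insert_eq_cons, Multiset.map_cons, Multiset.sum_cons,
      Multiset.map_singleton, Multiset.sum_singleton, oddOddKernel]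
    linarith [h.fork x, h.fork y, h.ite_le ⊥ y x ⊥, h.ite_le ⊥ x y ⊥,
      h.ite_le x ⊤ ⊤ y, h.ite_le y ⊤ ⊤ x]

theorem oddOdd_tripod_tripod {c : L × L → ℝ} {μ : ℝ} (h : EvenTest c μ) (z w : L) :
    (Multiset.map (fun p => (Multiset.map (fun q => oddOddKernel c p q)
      {(true, ⊤, w), (true, w, ⊤), (false, ⊥, w), (false, w, ⊥)}).sum)
      {(true, ⊤, z), (true, z, ⊤), (false, ⊥, z), (false, z, ⊥)}).sum ≤
      √6 * √6 * (√6 * μ) := by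
  obtain ⟨h1, h2, h3, h4⟩ := sqrt_six_bounds h.mu_nonneg
  have hM := h.nonneg ⊤ ⊥
  have hc := h.cherry
  simp only [Multiset.insert_eq_cons, Multiset.map_cons, Multiset.sum_cons,
    Multiset.map_singleton, Multiset.sum_singleton, oddOddKernel]
  have e3 : c (w, z) ≤ c (w, ⊥) := h.mono le_rfl bot_le
  have e4 : c (z, w) ≤ c (⊤, w) := h.mono le_top le_rfl
  linarith [h.fork z, h.fork w, h.ite_le_gate w z ⊤ ⊥, h.ite_le_gate z w ⊤ ⊥,
    gate_add_gate_le hM (le_refl z) (le_refl w), h.ite_le ⊥ z ⊤ w, h.ite_le ⊥ ⊤ z w,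
    h.ite_le w ⊤ z ⊥, h.ite_le ⊥ w ⊤ z, h.ite_le ⊥ ⊤ w z, h.ite_le z ⊤ w ⊥]

theorem oddOdd_tripod_free {c : L × L → ℝ} {μ : ℝ} (h : EvenTest c μ) (z : L) :
    (Multiset.map (fun p => (Multiset.map (fun q => oddOddKernel c p q)
      {(true, ⊤, ⊤), (false, ⊥, ⊥)}).sum)
      {(true, ⊤, z), (true, z, ⊤), (false, ⊥, z), (false, z, ⊥)}).sum ≤
      √6 * (2 * √6 / 3) * (√6 * μ) := by
  obtain ⟨h1, h2, h3, h4⟩ := sqrt_six_bounds h.mu_nonneg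
  have hc := h.cherry
  simp only [Multiset.insert_eq_cons, Multiset.map_cons, Multiset.sum_cons,
    Multiset.map_singleton, Multiset.sum_singleton, oddOddKernel]
  linarith [h.fork z, h.ite_le ⊥ z ⊤ ⊥, h.ite_le ⊥ ⊤ z ⊥, h.ite_le ⊥ ⊤ ⊤ z, h.ite_le z ⊤ ⊤ ⊥]

theorem oddOdd_free_free {c : L × L → ℝ} {μ : ℝ} (h : EvenTest c μ) :
    (Multiset.map (fun p => (Multiset.map (fun q => oddOddKernel c p q)
      {(true, ⊤, ⊤), (false, ⊥, ⊥)}).sum) {(true, ⊤, ⊤), (false, ⊥, ⊥)}).sum ≤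
      2 * √6 / 3 * (2 * √6 / 3) * (√6 * μ) := by
  obtain ⟨h1, h2, h3, h4⟩ := sqrt_six_bounds h.mu_nonneg
  have hc := h.cherry
  have hM := h.nonneg ⊤ ⊥
  simp only [Multiset.insert_eq_cons, Multiset.map_cons, Multiset.sum_cons,
    Multiset.map_singleton, Multiset.sum_singleton, oddOddKernel]
  linarith [h.ite_le ⊥ ⊤ ⊤ ⊥]

theorem oddOdd_atoms {c : L × L → ℝ} {μ : ℝ} (h : EvenTest c μ)
    {a a' : Multiset (Bool × L × L)} {w w' : ℝ} (ha : OddAtom a w) (ha' : OddAtom a' w') :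
    (a.map fun x => (a'.map fun y => oddOddKernel c x y).sum).sum ≤ w * w' * (√6 * μ) := by
  have swap : ∀ b b' : Multiset (Bool × L × L),
      (b.map fun x => (b'.map fun y => oddOddKernel c x y).sum).sum =
      (b'.map fun x => (b.map fun y => oddOddKernel c x y).sum).sum := fun b b' => by
    rw [Multiset.sum_map_sum_map]
    simp_rw [oddOddKernel_comm c]
  cases ha with
  | leaf x y => exact oddOdd_leaf h x y ha'
  | tripod z =>
    cases ha' with
    | leaf x y => rw [swap, mul_comm √6 2]; exact oddOdd_leaf h x y (.tripod z)
    | tripod w => exact oddOdd_tripod_tripod h z w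
    | free => exact oddOdd_tripod_free h z
  | free =>
    cases ha' with
    | leaf x y => rw [swap, mul_comm _ 2]; exact oddOdd_leaf h x y .free
    | tripod w => rw [swap, mul_comm _ √6]; exact oddOdd_tripod_free h w
    | free => exact oddOdd_free_free h

end Atoms

/-- A descent if `b`, an ascent otherwise. -/
def Step (b : Bool) (x y : ℕ) : Prop := if b then y < x else x < y

theorem step_not (b : Bool) (x y : ℕ) : Step (!b) x y ↔ Step b y x := by
  cases b <;> simp [Step]

/-- Consecutive entries alternately descend and ascend, starting with a descent iff `b`. -/
def Zig : Bool → List ℕ → Prop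
  | _, [] => True
  | _, [_] => True
  | b, x :: y :: l => Step b x y ∧ Zig (!b) (y :: l)

theorem zig_append (b : Bool) (u v : List ℕ) (hu : u ≠ []) (hv : v ≠ []) :
    Zig b (u ++ v) ↔ Zig b u ∧ Step (!(b ^^ u.length.bodd)) (u.getLastD 0) (v.headD 0) ∧
      Zig (b ^^ u.length.bodd) v := by
  induction u generalizing b with
  | nil => exact absurd rfl hu
  | cons x u ih =>
    cases u with
    | nil =>
      obtain ⟨y, v, rfl⟩ := List.exists_cons_of_ne_nil hv
      simp [Zig]
    | cons y u =>
      have := ih (!b) (by simp)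
      simp only [List.cons_append, Zig] at this ⊢
      rw [this]
      simp [and_assoc]

theorem zig_reverse (b : Bool) (w : List ℕ) :
    Zig b w.reverse ↔ Zig (b ^^ !w.length.bodd) w := by
  induction w generalizing b with
  | nil => simp [Zig]
  | cons x w ih =>
    cases w with
    | nil => simp [Zig]
    | cons y w =>
      rw [List.reverse_cons, zig_append _ _ _ (by simp) (by simp), ih]
      simp only [Zig, step_not]
      simp [and_comm]

theorem zig_true_of_isForwardAlternating {w : List ℕ} (h : IsForwardAlternating w) :
    Zig true w := by
  suffices ∀ b, (w.length ≤ 1 ∨ Step b (w.getD 0 0) (w.getD 1 0)) → Zig b w from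
    this true (by simpa [Step] using h.2)
  obtain ⟨h, -⟩ := h
  induction w with
  | nil => simp [Zig]
  | cons x w ih =>
    cases w with
    | nil => simp [Zig]
    | cons y w =>
      intro b hb
      simp at hb
      refine ⟨hb, ih ⟨fun i hi => ?_, fun i hi => ?_⟩ _ ?_⟩
      · simpa using h.1 (i + 1) (by simpa using hi)
      · simpa using h.2 (i + 1) (by simpa using hi)
      · cases w with
        | nil => simp
        | cons z w =>
          have h1 := h.1 0 (by simp)
          have h2 := h.1 1 (by simp)
          have h3 := h.2 0 (by simp)
          right
          cases b <;> simp [Step] at * <;> omega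

theorem Zig.isForwardAlternating {w : List ℕ} (h : Zig true w) : IsForwardAlternating w := by
  suffices ∀ b, Zig b w → IsAlternating w ∧ (w.length ≤ 1 ∨ Step b (w.getD 0 0) (w.getD 1 0)) by
    simpa [Step, IsForwardAlternating] using this true h
  clear h
  induction w with
  | nil => simp [IsAlternating]
  | cons x w ih =>
    cases w with
    | nil => simp [IsAlternating]
    | cons y w =>
      rintro b ⟨hb, hz⟩
      obtain ⟨⟨h1, h2⟩, h3⟩ := ih _ hz
      refine ⟨⟨fun i hi => ?_, fun i hi => ?_⟩, Or.inr (by simpa using hb)⟩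
      · cases i with
        | zero => cases b <;> simp [Step] at * <;> omega
        | succ i => simpa using h1 i (by simpa using hi)
      · cases i with
        | zero =>
          cases w with
          | nil => simp at hi
          | cons z w => cases b <;> simp [Step] at * <;> omega
        | succ i => simpa using h2 i (by simpa using hi)

namespace BTree

/-- The expansion of a tree, with multiplicity. -/
def wordMultiset : BTree → Multiset (List ℕ)
  | leaf a => {[a]}
  | node l r => l.wordMultiset.bind fun u => r.wordMultiset.bind fun v => {u ++ v, v ++ u}

theorem mem_wordMultiset {t : BTree} {w : List ℕ} : w ∈ t.wordMultiset ↔ w ∈ t.words := by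
  induction t generalizing w with
  | leaf a => simp [wordMultiset, words]
  | node l r ihl ihr =>
    simp only [wordMultiset, words, Multiset.mem_bind, ihl, ihr, Finset.mem_union, Finset.mem_image,
      Finset.mem_product, Prod.exists, Multiset.insert_eq_cons, Multiset.mem_cons,
      Multiset.mem_singleton]
    constructor
    · rintro ⟨u, hu, v, hv, rfl | rfl⟩
      · exact .inl ⟨u, v, ⟨hu, hv⟩, rfl⟩
      · exact .inr ⟨u, v, ⟨hu, hv⟩, rfl⟩
    · rintro (⟨u, v, ⟨hu, hv⟩, rfl⟩ | ⟨u, v, ⟨hu, hv⟩, rfl⟩)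
      · exact ⟨u, hu, v, hv, .inl rfl⟩
      · exact ⟨u, hu, v, hv, .inr rfl⟩

theorem perm_leaves_of_mem_words {t : BTree} {w : List ℕ} (h : w ∈ t.words) :
    w.Perm t.leaves := by
  induction t generalizing w with
  | leaf a => simp_all [words, leaves]
  | node l r ihl ihr =>
    simp only [words, Finset.mem_union, Finset.mem_image, Finset.mem_product, Prod.exists] at h
    obtain ⟨u, v, ⟨hu, hv⟩, rfl⟩ | ⟨u, v, ⟨hu, hv⟩, rfl⟩ := h
    · exact (ihl hu).append (ihr hv)
    · exact List.perm_append_comm.trans ((ihl hu).append (ihr hv))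

theorem leaves_length_pos (t : BTree) : 0 < t.leaves.length := by
  induction t with
  | leaf a => simp [leaves]
  | node l r ihl ihr => simp [leaves]; omega

theorem length_of_mem {t : BTree} {w : List ℕ} (h : w ∈ t.wordMultiset) :
    w.length = t.leaves.length := (perm_leaves_of_mem_words (mem_wordMultiset.1 h)).length_eq

theorem ne_nil_of_mem {t : BTree} {w : List ℕ} (h : w ∈ t.wordMultiset) : w ≠ [] := by
  rw [← List.length_pos_iff, length_of_mem h]
  exact t.leaves_length_pos

theorem wordMultiset_node_comm (l r : BTree) :
    (node l r).wordMultiset = (node r l).wordMultiset := by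
  rw [wordMultiset, wordMultiset, Multiset.bind_bind]
  exact Multiset.bind_congr fun v _ => Multiset.bind_congr fun u _ => Multiset.pair_comm _ _

theorem map_reverse_wordMultiset (t : BTree) :
    t.wordMultiset.map List.reverse = t.wordMultiset := by
  induction t with
  | leaf a => simp [wordMultiset]
  | node l r ihl ihr =>
    conv_rhs => rw [wordMultiset, ← ihl, Multiset.bind_map]
    rw [wordMultiset, Multiset.map_bind]
    refine Multiset.bind_congr fun u _ => ?_
    conv_rhs => rw [← ihr, Multiset.bind_map]
    rw [Multiset.map_bind]
    refine Multiset.bind_congr fun v _ => ?_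
    simpa using Multiset.pair_comm _ _

theorem sum_map_node (l r : BTree) (f : List ℕ → ℝ) :
    ((node l r).wordMultiset.map f).sum = (l.wordMultiset.map fun u =>
      (r.wordMultiset.map fun v => f (u ++ v) + f (v ++ u)).sum).sum := by
  simp [wordMultiset, Multiset.map_bind, Multiset.sum_bind]

theorem sum_map_reverse (t : BTree) (f : List ℕ → ℝ) :
    (t.wordMultiset.map fun w => f w.reverse).sum = (t.wordMultiset.map f).sum := by
  conv_rhs => rw [← map_reverse_wordMultiset, Multiset.map_map]
  rfl

/-- First and last letter. -/
def ends (w : List ℕ) : ℕ∞ × ℕ∞ := (w.headD 0, w.getLastD 0)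

/-- The ends of the words `w` in the expansion with `Zig b w`. -/
noncomputable def zigEnds (t : BTree) (b : Bool) : Multiset (ℕ∞ × ℕ∞) :=
  (t.wordMultiset.filter (Zig b)).map ends

theorem sum_map_filter_eq {α : Type*} (m : Multiset α) (p : α → Prop) [DecidablePred p]
    (f : α → ℝ) :
    ((m.filter p).map f).sum = (m.map fun x => if p x then f x else 0).sum := by
  induction m using Multiset.induction with
  | empty => simp
  | cons a m ih => by_cases h : p a <;> simp [h, ih]

theorem sum_map_zigEnds (t : BTree) (b : Bool) (c : ℕ∞ × ℕ∞ → ℝ) :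
    ((t.zigEnds b).map c).sum =
      (t.wordMultiset.map fun w => if Zig b w then c (ends w) else 0).sum := by
  rw [zigEnds, Multiset.map_map, sum_map_filter_eq]
  rfl

/-- The ends of all alternating words, tagged by whether they start with a descent. -/
noncomputable def signedZigEnds (t : BTree) : Multiset (Bool × ℕ∞ × ℕ∞) :=
  (t.zigEnds true).map (Prod.mk true) + (t.zigEnds false).map (Prod.mk false)

theorem sum_map_signedZigEnds (t : BTree) (c : Bool × ℕ∞ × ℕ∞ → ℝ) :
    (t.signedZigEnds.map c).sum = ((t.zigEnds true).map fun x => c (true, x)).sum +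
      ((t.zigEnds false).map fun x => c (false, x)).sum := by
  simp [signedZigEnds]

theorem sum_map_zigEnds₂ (l r : BTree) (b b' : Bool) (κ : ℕ∞ × ℕ∞ → ℕ∞ × ℕ∞ → ℝ) :
    ((l.zigEnds b).map fun x => ((r.zigEnds b').map fun y => κ x y).sum).sum =
      (l.wordMultiset.map fun u => (r.wordMultiset.map fun v =>
        if Zig b u ∧ Zig b' v then κ (ends u) (ends v) else 0).sum).sum := by
  rw [sum_map_zigEnds]
  refine congrArg _ (Multiset.map_congr rfl fun u _ => ?_)
  rw [sum_map_zigEnds]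
  by_cases h : Zig b u <;> simp [h]

theorem bodd_of_even {n : ℕ} (h : Even n) : n.bodd = false := by
  obtain ⟨k, rfl⟩ := h
  simp

theorem bodd_of_odd {n : ℕ} (h : Odd n) : n.bodd = true := by
  obtain ⟨k, rfl⟩ := h
  simp [show Nat.bodd 2 = false from rfl]

theorem ends_append {u v : List ℕ} (hu : u ≠ []) (hv : v ≠ []) :
    ends (u ++ v) = ((ends u).1, (ends v).2) := by
  obtain ⟨a, u, rfl⟩ := List.exists_cons_of_ne_nil hu
  simp only [ends, List.getLastD_eq_getLast?, List.getLast?_append_of_ne_nil _ hv]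
  rfl

theorem ends_reverse (w : List ℕ) : ends w.reverse = (ends w).swap := by
  simp [ends, List.getLastD_eq_getLast?, List.headD_eq_head?_getD]

/-- The value of `c` at the ends of `w` if `Zig b w`, and `0` otherwise. -/
noncomputable def score (b : Bool) (c : ℕ∞ × ℕ∞ → ℝ) (w : List ℕ) : ℝ :=
  if Zig b w then c (ends w) else 0

/-- The analogue of `Step` on `ℕ∞`. -/
def StepEnds (b : Bool) (x y : ℕ∞) : Prop := if b then y < x else x < y

theorem score_append_of_even {u v : List ℕ} (hu : u ≠ []) (hv : v ≠ []) (h : Even u.length)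
    (b : Bool) (c : ℕ∞ × ℕ∞ → ℝ) :
    score b c (u ++ v) = if Zig b u ∧ Zig b v then
      if StepEnds (!b) (ends u).2 (ends v).1 then c ((ends u).1, (ends v).2) else 0 else 0 := by
  have h := bodd_of_even h
  have key : Zig b (u ++ v) ↔
      Zig b u ∧ StepEnds (!b) (ends u).2 (ends v).1 ∧ Zig (b) v := by
    rw [zig_append _ _ _ hu hv, h]
    cases b <;> simp [Step, StepEnds, ends]
  rw [score, ends_append hu hv]
  split_ifs <;> first | rfl | (exfalso; tauto)

theorem score_append_of_odd {u v : List ℕ} (hu : u ≠ []) (hv : v ≠ []) (h : Odd u.length)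
    (b : Bool) (c : ℕ∞ × ℕ∞ → ℝ) :
    score b c (u ++ v) = if Zig b u ∧ Zig (!b) v then
      if StepEnds b (ends u).2 (ends v).1 then c ((ends u).1, (ends v).2) else 0 else 0 := by
  have h := bodd_of_odd h
  have key : Zig b (u ++ v) ↔
      Zig b u ∧ StepEnds (b) (ends u).2 (ends v).1 ∧ Zig (!b) v := by
    rw [zig_append _ _ _ hu hv, h]
    cases b <;> simp [Step, StepEnds, ends]
  rw [score, ends_append hu hv]
  split_ifs <;> first | rfl | (exfalso; tauto)

theorem sum_node_even_even {l r : BTree} (hl : Even l.leaves.length) (hr : Even r.leaves.length)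
    (c : ℕ∞ × ℕ∞ → ℝ) :
    (((node l r).zigEnds true).map c).sum = ((l.zigEnds true).map fun x =>
      ((r.zigEnds true).map fun y => evenEvenKernel c x y).sum).sum := by
  rw [sum_map_zigEnds, sum_map_zigEnds₂, sum_map_node]
  refine congrArg _ (Multiset.map_congr rfl fun u hu =>
    congrArg _ (Multiset.map_congr rfl fun v hv => ?_))
  have nu := ne_nil_of_mem hu
  have nv := ne_nil_of_mem hv
  rw [← length_of_mem hu] at hl
  rw [← length_of_mem hv] at hr
  refine (congrArg₂ (· + ·) (score_append_of_even nu nv hl true c)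
    (score_append_of_even nv nu hr true c)).trans ?_
  by_cases h1 : Zig true u <;> by_cases h2 : Zig true v <;>
    simp [h1, h2, evenEvenKernel, StepEnds]

theorem sum_node_odd_odd {l r : BTree} (hl : Odd l.leaves.length) (hr : Odd r.leaves.length)
    (c : ℕ∞ × ℕ∞ → ℝ) :
    (((node l r).zigEnds true).map c).sum = (l.signedZigEnds.map fun x =>
      (r.signedZigEnds.map fun y => oddOddKernel c x y).sum).sum := by
  simp only [sum_map_signedZigEnds, Multiset.sum_map_add, sum_map_zigEnds₂]
  rw [sum_map_zigEnds, sum_map_node]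
  simp only [← Multiset.sum_map_add]
  refine congrArg _ (Multiset.map_congr rfl fun u hu =>
    congrArg _ (Multiset.map_congr rfl fun v hv => ?_))
  have nu := ne_nil_of_mem hu
  have nv := ne_nil_of_mem hv
  rw [← length_of_mem hu] at hl
  rw [← length_of_mem hv] at hr
  refine (congrArg₂ (· + ·) (score_append_of_odd nu nv hl true c)
    (score_append_of_odd nv nu hr true c)).trans ?_
  by_cases h1 : Zig true u <;> by_cases h2 : Zig true v <;> by_cases h3 : Zig false u <;>
    by_cases h4 : Zig false v <;> simp [h1, h2, h3, h4, oddOddKernel, StepEnds, add_comm]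

theorem sum_node_odd_even {l r : BTree} (hl : Odd l.leaves.length) (hr : Even r.leaves.length)
    (c : Bool × ℕ∞ × ℕ∞ → ℝ) :
    ((node l r).signedZigEnds.map c).sum = (l.signedZigEnds.map fun x =>
      ((r.zigEnds true).map fun y => oddEvenKernel c x y).sum).sum := by
  simp only [sum_map_signedZigEnds, sum_map_zigEnds₂]
  have key : ∀ b, (((node l r).zigEnds b).map fun x => c (b, x)).sum =
      (l.wordMultiset.map fun u => (r.wordMultiset.map fun v =>
        if Zig b u ∧ Zig true v then oddEvenKernel c (b, ends u) (ends v) else 0).sum).sum := by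
    intro b
    rw [sum_map_zigEnds, sum_map_node]
    refine congrArg _ (Multiset.map_congr rfl fun u hu => ?_)
    have nu := ne_nil_of_mem hu
    rw [← length_of_mem hu] at hl
    have even : ∀ v ∈ r.wordMultiset, Even v.length := fun v hv => length_of_mem hv ▸ hr
    cases b
    · rw [Multiset.sum_map_add, ← sum_map_reverse r fun v => if Zig false (v ++ u) then _ else _,
        ← Multiset.sum_map_add]
      refine congrArg _ (Multiset.map_congr rfl fun v hv => ?_)
      have nv := ne_nil_of_mem hv
      have ev := even v hv
      refine (congrArg₂ (· + ·) (score_append_of_odd nu nv hl false fun x => c (false, x))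
        (score_append_of_even (List.reverse_ne_nil_iff.2 nv) nu (by simpa using ev) false
          fun x => c (false, x))).trans ?_
      have := bodd_of_even ev
      rw [zig_reverse, ends_reverse, this]
      by_cases h1 : Zig false u <;> by_cases h2 : Zig true v <;>
        simp [h1, h2, oddEvenKernel, StepEnds, add_comm]
    · rw [Multiset.sum_map_add, ← sum_map_reverse r fun v => if Zig true (u ++ v) then _ else _,
        ← Multiset.sum_map_add]
      refine congrArg _ (Multiset.map_congr rfl fun v hv => ?_)
      have nv := ne_nil_of_mem hv
      have ev := even v hv
      refine (congrArg₂ (· + ·) (score_append_of_odd nu (List.reverse_ne_nil_iff.2 nv) hl true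
          fun x => c (true, x))
        (score_append_of_even nv nu ev true fun x => c (true, x))).trans ?_
      have := bodd_of_even ev
      rw [zig_reverse, ends_reverse, this]
      by_cases h1 : Zig true u <;> by_cases h2 : Zig true v <;>
        simp [h1, h2, oddEvenKernel, StepEnds, add_comm]
  rw [key, key]

theorem dominated_node_even_even {l r : BTree} (hl : Even l.leaves.length)
    (hr : Even r.leaves.length) {q q' : ℝ} (dl : Dominated EvenRel EvenAtom (l.zigEnds true) q)
    (dr : Dominated EvenRel EvenAtom (r.zigEnds true) q') :
    Dominated EvenRel EvenAtom ((node l r).zigEnds true) (q * q') := fun c μ h => by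
  have h := h.even
  rw [sum_node_even_even hl hr]
  exact dl.tensor dr _ _
    (fun x y => add_nonneg (ite_zero_nonneg (h.nonneg _ _)) (ite_zero_nonneg (h.nonneg _ _)))
    (fun x x' y hx => add_le_add
      (ite_zero_mono hx.2.trans_lt (h.mono hx.1 le_rfl) (h.nonneg _ _))
      (ite_zero_mono (fun k => k.trans_le hx.1) (h.mono le_rfl hx.2) (h.nonneg _ _)))
    (fun x y y' hy => add_le_add
      (ite_zero_mono (fun k => k.trans_le hy.1) (h.mono le_rfl hy.2) (h.nonneg _ _))
      (ite_zero_mono hy.2.trans_lt (h.mono hy.1 le_rfl) (h.nonneg _ _)))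
    fun _ _ _ _ => evenEven_atoms h

theorem dominated_node_odd_even {l r : BTree} (hl : Odd l.leaves.length)
    (hr : Even r.leaves.length) {q q' : ℝ} (dl : Dominated OddRel OddAtom l.signedZigEnds q)
    (dr : Dominated EvenRel EvenAtom (r.zigEnds true) q') :
    Dominated OddRel OddAtom (node l r).signedZigEnds (q * q') := fun c μ h => by
  have h := h.odd
  rw [sum_node_odd_even hl hr]
  refine dl.tensor dr _ _ ?_ ?_ ?_ fun _ _ _ _ => oddEven_atoms h
  · rintro ⟨_ | _, x, y⟩ ⟨s, e⟩ <;>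
      exact add_nonneg (ite_zero_nonneg (h.nonneg _ _ _)) (ite_zero_nonneg (h.nonneg _ _ _))
  · rintro ⟨_ | _, x, y⟩ ⟨_ | _, x', y'⟩ ⟨s, e⟩ hx <;> first | exact hx.elim | skip
    · exact add_le_add
        (ite_zero_mono hx.1.trans_lt (h.mono_false le_rfl hx.2) (h.nonneg _ _ _))
        (ite_zero_mono hx.2.trans_lt (h.mono_false hx.1 le_rfl) (h.nonneg _ _ _))
    · exact add_le_add
        (ite_zero_mono (fun k => k.trans_le hx.1) (h.mono_true le_rfl hx.2) (h.nonneg _ _ _))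
        (ite_zero_mono (fun k => k.trans_le hx.2) (h.mono_true hx.1 le_rfl) (h.nonneg _ _ _))
  · rintro ⟨_ | _, x, y⟩ ⟨s, e⟩ ⟨s', e'⟩ hy
    · exact add_le_add
        (ite_zero_mono (fun k => k.trans_le hy.1) (h.mono_false hy.2 le_rfl) (h.nonneg _ _ _))
        (ite_zero_mono (fun k => k.trans_le hy.1) (h.mono_false le_rfl hy.2) (h.nonneg _ _ _))
    · exact add_le_add
        (ite_zero_mono hy.2.trans_lt (h.mono_true hy.1 le_rfl) (h.nonneg _ _ _))
        (ite_zero_mono hy.2.trans_lt (h.mono_true le_rfl hy.1) (h.nonneg _ _ _))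

theorem dominated_node_odd_odd {l r : BTree} (hl : Odd l.leaves.length)
    (hr : Odd r.leaves.length) {q q' : ℝ} (dl : Dominated OddRel OddAtom l.signedZigEnds q)
    (dr : Dominated OddRel OddAtom r.signedZigEnds q') :
    Dominated EvenRel EvenAtom ((node l r).zigEnds true) (q * q' * √6) := fun c μ h => by
  have h := h.even
  have mono : ∀ x x' y, OddRel x x' → oddOddKernel c x y ≤ oddOddKernel c x' y := by
    rintro ⟨_ | _, x, y⟩ ⟨_ | _, x', y'⟩ ⟨_ | _, s, e⟩ hx <;>
      first | exact hx.elim | exact le_rfl | skip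
    · exact ite_zero_mono hx.1.trans_lt (h.mono le_rfl hx.2) (h.nonneg _ _)
    · exact ite_zero_mono (fun k => k.trans_le hx.2) (h.mono hx.1 le_rfl) (h.nonneg _ _)
  rw [sum_node_odd_odd hl hr, mul_assoc]
  refine dl.tensor dr _ _ ?_ mono (fun x y y' hy => ?_) fun _ _ _ _ => oddOdd_atoms h
  · rintro ⟨_ | _, x, y⟩ ⟨_ | _, s, e⟩ <;>
      first | exact le_rfl | exact ite_zero_nonneg (h.nonneg _ _)
  · rw [oddOddKernel_comm c x y, oddOddKernel_comm c x y']
    exact mono _ _ _ hy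

theorem dominated_leaf (a : ℕ) : Dominated OddRel OddAtom (leaf a).signedZigEnds 1 :=
  fun c μ h => by
  have h := h.odd.leaf a a
  have z : ∀ b, Zig b [a] := fun b => by simp [Zig]
  simp [sum_map_signedZigEnds, sum_map_zigEnds, wordMultiset, z, ends]
  linarith

theorem signedZigEnds_node_comm (l r : BTree) :
    (node l r).signedZigEnds = (node r l).signedZigEnds := by
  simp only [signedZigEnds, zigEnds, wordMultiset_node_comm]

theorem dominated (t : BTree) :
    (Even t.leaves.length → Dominated EvenRel EvenAtom (t.zigEnds true)
      ((6 : ℝ) ^ ((t.leaves.length : ℝ) / 4))) ∧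
    (Odd t.leaves.length → Dominated OddRel OddAtom t.signedZigEnds
      ((6 : ℝ) ^ (((t.leaves.length : ℝ) - 1) / 4))) := by
  have six : (0 : ℝ) < 6 := by norm_num
  induction t with
  | leaf a => simpa [leaves] using dominated_leaf a
  | node l r ihl ihr =>
    rcases Nat.even_or_odd l.leaves.length with hl | hl <;>
      rcases Nat.even_or_odd r.leaves.length with hr | hr
    · refine ⟨fun _ => ?_, fun h => ?_⟩
      · convert dominated_node_even_even hl hr (ihl.1 hl) (ihr.1 hr) using 1
        rw [← Real.rpow_add six]
        congr 1
        simp [leaves]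
        ring
      · simp [leaves, ← Nat.not_even_iff_odd, hl.add hr] at h
    · refine ⟨fun h => ?_, fun _ => ?_⟩
      · simp [leaves, ← Nat.not_odd_iff_even, hl.add_odd hr] at h
      · rw [signedZigEnds_node_comm]
        convert dominated_node_odd_even hr hl (ihr.2 hr) (ihl.1 hl) using 1
        rw [← Real.rpow_add six]
        congr 1
        simp [leaves]
        ring
    · refine ⟨fun h => ?_, fun _ => ?_⟩
      · simp [leaves, ← Nat.not_odd_iff_even, hl.add_even hr] at h
      · convert dominated_node_odd_even hl hr (ihl.2 hl) (ihr.1 hr) using 1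
        rw [← Real.rpow_add six]
        congr 1
        simp [leaves]
        ring
    · refine ⟨fun _ => ?_, fun h => ?_⟩
      · convert dominated_node_odd_odd hl hr (ihl.2 hl) (ihr.2 hr) using 1
        rw [Real.sqrt_eq_rpow, ← Real.rpow_add six, ← Real.rpow_add six]
        congr 1
        simp [leaves]
        ring
      · simp [leaves, ← Nat.not_even_iff_odd, hl.add_odd hr] at h

theorem faltCount_le_card (t : BTree) : faltCount t ≤ (t.zigEnds true).card := by
  rw [zigEnds, Multiset.card_map, faltCount]
  refine (Finset.card_le_card fun w hw => ?_).trans (Multiset.toFinset_card_le _)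
  rw [Finset.mem_filter] at hw
  rw [Multiset.mem_toFinset, Multiset.mem_filter]
  exact ⟨mem_wordMultiset.2 hw.1, zig_true_of_isForwardAlternating hw.2⟩

theorem faltCount_le (t : BTree) : (faltCount t : ℝ) ≤ (6 : ℝ) ^ ((t.leaves.length : ℝ) / 4) := by
  refine (Nat.cast_le.2 t.faltCount_le_card).trans ?_
  have s6 : (2.449 : ℝ) ≤ √6 := by simpa using (sqrt_six_bounds (zero_le_one' ℝ)).1
  have hq : (0 : ℝ) < 6 ^ ((t.leaves.length : ℝ) / 4) := by positivity
  rcases Nat.even_or_odd t.leaves.length with h | h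
  · have := t.dominated.1 h (fun _ => 1) (1 / 2) ⟨fun _ => zero_le_one, fun _ _ _ => le_rfl,
      fun m w hm => by cases hm <;> simp <;> linarith⟩
    simp at this
    linarith
  · have := t.dominated.2 h (fun x => if x.1 then 1 else 0) 1 ⟨fun x => by split_ifs <;> simp,
      fun x y hxy => by obtain ⟨_ | _, x⟩ := x <;> obtain ⟨_ | _, y⟩ := y <;> simp_all [OddRel],
      fun m w hm => by cases hm <;> simp <;> linarith⟩
    simp [sum_map_signedZigEnds] at this
    refine this.trans (Real.rpow_le_rpow_of_exponent_le (by norm_num) ?_)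
    linarith

end BTree

namespace BTree

theorem append_mem_words {l r : BTree} {u v : List ℕ} (hu : u ∈ l.words) (hv : v ∈ r.words) :
    u ++ v ∈ (node l r).words :=
  Finset.mem_union_left _ (Finset.mem_image.2 ⟨(u, v), Finset.mem_product.2 ⟨hu, hv⟩, rfl⟩)

theorem append_mem_words' {l r : BTree} {u v : List ℕ} (hu : u ∈ l.words) (hv : v ∈ r.words) :
    v ++ u ∈ (node l r).words :=
  Finset.mem_union_right _ (Finset.mem_image.2 ⟨(u, v), Finset.mem_product.2 ⟨hu, hv⟩, rfl⟩)

/-- The forward alternating words in the expansion of `t`. -/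
noncomputable def zigWords (t : BTree) : Finset (List ℕ) := t.words.filter (Zig true)

theorem faltCount_eq_card_zigWords (t : BTree) : faltCount t = t.zigWords.card := by
  unfold faltCount zigWords
  congr 1
  exact Finset.filter_congr fun w _ => ⟨zig_true_of_isForwardAlternating, Zig.isForwardAlternating⟩

theorem mem_zigWords {t : BTree} {w : List ℕ} : w ∈ t.zigWords ↔ w ∈ t.words ∧ Zig true w :=
  Finset.mem_filter

theorem length_of_mem_words {t : BTree} {w : List ℕ} (h : w ∈ t.words) :
    w.length = t.leaves.length := (perm_leaves_of_mem_words h).length_eq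

theorem ne_nil_of_mem_words {t : BTree} {w : List ℕ} (h : w ∈ t.words) : w ≠ [] :=
  ne_nil_of_mem (mem_wordMultiset.2 h)

theorem getLastD_mem_leaves {t : BTree} {w : List ℕ} (h : w ∈ t.words) :
    w.getLastD 0 ∈ t.leaves := by
  rw [← (perm_leaves_of_mem_words h).mem_iff, List.getLastD_eq_getLast?,
    List.getLast?_eq_some_getLast (ne_nil_of_mem_words h)]
  exact List.getLast_mem _

theorem headD_mem_leaves {t : BTree} {w : List ℕ} (h : w ∈ t.words) :
    w.headD 0 ∈ t.leaves := by
  rw [← (perm_leaves_of_mem_words h).mem_iff, List.headD_eq_head?_getD,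
    List.head?_eq_some_head (ne_nil_of_mem_words h)]
  exact List.head_mem _

theorem faltCount_le_faltCount_node {t s : BTree} {v : List ℕ} (hv : v ∈ s.words)
    (zig : Zig (true ^^ t.leaves.length.bodd) v)
    (step : ∀ x ∈ t.leaves, Step (!(true ^^ t.leaves.length.bodd)) x (v.headD 0)) :
    faltCount t ≤ faltCount (node t s) := by
  rw [faltCount_eq_card_zigWords, faltCount_eq_card_zigWords]
  refine Finset.card_le_card_of_injOn (· ++ v) (fun u hu => ?_)
    fun u _ u' _ h => List.append_left_injective v h
  obtain ⟨hu, hz⟩ := mem_zigWords.1 hu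
  refine mem_zigWords.2 ⟨append_mem_words hu hv, ?_⟩
  rw [zig_append _ _ _ (ne_nil_of_mem_words hu) (ne_nil_of_mem_words hv), length_of_mem_words hu]
  exact ⟨hz, step _ (getLastD_mem_leaves hu), zig⟩

/-- A tree on the letters `m + 1, …, m + 4` with three forward alternating words. -/
def quad (m : ℕ) : BTree :=
  node (node (node (leaf (m + 1)) (leaf (m + 4))) (leaf (m + 2))) (leaf (m + 3))

/-- The forward alternating words in the expansion of `quad m`. -/
def quadWords (m : ℕ) : Finset (List ℕ) :=
  {[m + 2, m + 1, m + 4, m + 3], [m + 3, m + 1, m + 4, m + 2], [m + 3, m + 2, m + 4, m + 1]}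

theorem card_quadWords (m : ℕ) : (quadWords m).card = 3 := by
  rw [quadWords, Finset.card_eq_three]
  exact ⟨_, _, _, by simp, by simp, by simp, rfl⟩

theorem mem_words_of_mem_quadWords {m : ℕ} {σ : List ℕ} (h : σ ∈ quadWords m) :
    σ ∈ (quad m).words ∧ σ.reverse ∈ (quad m).words := by
  simp only [quadWords, Finset.mem_insert, Finset.mem_singleton] at h
  obtain rfl | rfl | rfl := h <;> simp [quad, words]

theorem zig_of_mem_quadWords {m : ℕ} {σ : List ℕ} (h : σ ∈ quadWords m) : Zig true σ := by
  simp only [quadWords, Finset.mem_insert, Finset.mem_singleton] at h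
  obtain rfl | rfl | rfl := h <;> simp [Zig, Step]

theorem six_mul_faltCount_le {t : BTree} {m : ℕ} (odd : Odd t.leaves.length)
    (lt : ∀ x ∈ t.leaves, m + 4 < x) : 6 * faltCount t ≤ faltCount (node t (quad m)) := by
  have quad_le : ∀ x ∈ (quad m).leaves, x ≤ m + 4 := by simp [quad, leaves]
  have length_quad : ∀ {σ}, σ ∈ quadWords m → σ.length = 4 := fun h =>
    length_of_mem_words (mem_words_of_mem_quadWords h).1
  have left : Set.InjOn (fun x : List ℕ × List ℕ => x.1 ++ x.2)
      (quadWords m ×ˢ t.zigWords : Set (List ℕ × List ℕ)) := by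
    rintro ⟨σ, u⟩ ⟨hσ, hu⟩ ⟨τ, v⟩ ⟨hτ, hv⟩ h
    obtain ⟨h1, h2⟩ := List.append_inj h ((length_quad hσ).trans (length_quad hτ).symm)
    exact Prod.ext h1 h2
  have right : Set.InjOn (fun x : List ℕ × List ℕ => x.2 ++ x.1.reverse)
      (quadWords m ×ˢ t.zigWords : Set (List ℕ × List ℕ)) := by
    rintro ⟨σ, u⟩ ⟨hσ, hu⟩ ⟨τ, v⟩ ⟨hτ, hv⟩ h
    obtain ⟨h1, h2⟩ := List.append_inj h ((length_of_mem_words (mem_zigWords.1 hu).1).trans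
      (length_of_mem_words (mem_zigWords.1 hv).1).symm)
    exact Prod.ext (List.reverse_injective h2) h1
  have disjoint : Disjoint (Finset.image₂ (fun σ u => σ ++ u) (quadWords m) t.zigWords)
      (Finset.image₂ (fun σ u => u ++ σ.reverse) (quadWords m) t.zigWords) := by
    refine Finset.disjoint_left.2 fun w hw hw' => ?_
    obtain ⟨σ, hσ, u, hu, rfl⟩ := Finset.mem_image₂.1 hw
    obtain ⟨τ, hτ, v, hv, h⟩ := Finset.mem_image₂.1 hw'
    have mσ := (mem_words_of_mem_quadWords hσ).1
    have mv := (mem_zigWords.1 hv).1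
    have h1 := quad_le _ (headD_mem_leaves mσ)
    have h2 := lt _ (headD_mem_leaves mv)
    obtain ⟨x, σ, rfl⟩ := List.exists_cons_of_ne_nil (ne_nil_of_mem_words mσ)
    obtain ⟨y, v, rfl⟩ := List.exists_cons_of_ne_nil (ne_nil_of_mem_words mv)
    simp at h h1 h2
    omega
  have subset : Finset.image₂ (fun σ u => σ ++ u) (quadWords m) t.zigWords ∪
      Finset.image₂ (fun σ u => u ++ σ.reverse) (quadWords m) t.zigWords ⊆
        (node t (quad m)).zigWords := by
    refine Finset.union_subset (Finset.image₂_subset_iff.2 fun σ hσ u hu => ?_)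
      (Finset.image₂_subset_iff.2 fun σ hσ u hu => ?_)
    all_goals
      obtain ⟨mu, zu⟩ := mem_zigWords.1 hu
      obtain ⟨mσ, mσ'⟩ := mem_words_of_mem_quadWords hσ
      have zσ := zig_of_mem_quadWords hσ
      have nu := ne_nil_of_mem_words mu
    · refine mem_zigWords.2 ⟨append_mem_words' mu mσ, ?_⟩
      rw [zig_append _ _ _ (ne_nil_of_mem_words mσ) nu, length_quad hσ]
      exact ⟨zσ, (quad_le _ (getLastD_mem_leaves mσ)).trans_lt (lt _ (headD_mem_leaves mu)), zu⟩
    · refine mem_zigWords.2 ⟨append_mem_words mu mσ', ?_⟩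
      rw [zig_append _ _ _ nu (ne_nil_of_mem_words mσ'), length_of_mem_words mu, bodd_of_odd odd,
        zig_reverse, length_quad hσ]
      exact ⟨zu, (quad_le _ (headD_mem_leaves mσ')).trans_lt (lt _ (getLastD_mem_leaves mu)), zσ⟩
  rw [faltCount_eq_card_zigWords, faltCount_eq_card_zigWords]
  refine le_trans ?_ (Finset.card_le_card subset)
  rw [Finset.card_union_of_disjoint disjoint, Finset.card_image₂_iff.2 left,
    Finset.card_image₂_iff.2 right, card_quadWords]
  omega

/-- A leaf joined successively with `k` copies of `quad`, on the letters
`m + 1, …, m + 4 * k + 1`. -/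
def caterpillar : ℕ → ℕ → BTree
  | 0, m => leaf (m + 1)
  | k + 1, m => node (caterpillar k (m + 4)) (quad m)

theorem leaves_caterpillar_perm (k m : ℕ) :
    (caterpillar k m).leaves.Perm (List.range' (m + 1) (4 * k + 1)) := by
  induction k generalizing m with
  | zero => simp [caterpillar, leaves]
  | succ k ih =>
    refine ((ih (m + 4)).append_right _).trans
      ((List.perm_ext_iff_of_nodup ?_ List.nodup_range').2 fun a => ?_)
    · simp [quad, leaves, List.nodup_append, List.nodup_range', List.mem_range'_1]
      omega
    · simp [quad, leaves, List.mem_range'_1]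
      omega

theorem mem_leaves_caterpillar {k m x : ℕ} :
    x ∈ (caterpillar k m).leaves ↔ m + 1 ≤ x ∧ x < m + 1 + (4 * k + 1) := by
  rw [(leaves_caterpillar_perm k m).mem_iff, List.mem_range'_1]

theorem length_leaves_caterpillar (k m : ℕ) : (caterpillar k m).leaves.length = 4 * k + 1 := by
  simpa using (leaves_caterpillar_perm k m).length_eq

theorem odd_length_leaves_caterpillar (k m : ℕ) : Odd (caterpillar k m).leaves.length :=
  ⟨2 * k, by rw [length_leaves_caterpillar]; ring⟩

theorem six_pow_le_faltCount_caterpillar (k m : ℕ) : 6 ^ k ≤ faltCount (caterpillar k m) := by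
  induction k generalizing m with
  | zero =>
    rw [faltCount_eq_card_zigWords]
    exact Finset.card_pos.2 ⟨[m + 1], mem_zigWords.2 ⟨by simp [caterpillar, words], by simp [Zig]⟩⟩
  | succ k ih =>
    rw [pow_succ']
    exact (Nat.mul_le_mul_left 6 (ih (m + 4))).trans (six_mul_faltCount_le
      (odd_length_leaves_caterpillar _ _) fun x hx => (mem_leaves_caterpillar.1 hx).1)

theorem exists_six_pow_le_faltCount {n : ℕ} (hn : 0 < n) :
    ∃ t : BTree, t.leaves.Perm (List.range' 1 n) ∧ 6 ^ ((n - 1) / 4) ≤ faltCount t := by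
  obtain ⟨k, r, hr, rfl⟩ : ∃ k r, r < 4 ∧ n = 4 * k + 1 + r :=
    ⟨(n - 1) / 4, (n - 1) % 4, by omega, by omega⟩
  have hk : (4 * k + 1 + r - 1) / 4 = k := by omega
  rw [hk]
  have bodd m : (caterpillar k m).leaves.length.bodd = true :=
    bodd_of_odd (odd_length_leaves_caterpillar k m)
  have one_leaf (m : ℕ) (hm : 0 < m) : 6 ^ k ≤ faltCount (node (caterpillar k m) (leaf 1)) := by
    refine (six_pow_le_faltCount_caterpillar k m).trans
      (faltCount_le_faltCount_node (v := [1]) (by simp [words]) (by simp [Zig]) fun x hx => ?_)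
    rw [mem_leaves_caterpillar] at hx
    simp [bodd, Step]
    omega
  have perm (m : ℕ) (t : BTree) (l : List ℕ) (ht : t.leaves = (caterpillar k m).leaves ++ l)
      (nodup : (List.range' (m + 1) (4 * k + 1) ++ l).Nodup)
      (mem : ∀ a, a ∈ List.range' (m + 1) (4 * k + 1) ++ l ↔ a ∈ List.range' 1 (4 * k + 1 + r)) :
      t.leaves.Perm (List.range' 1 (4 * k + 1 + r)) := by
    rw [ht]
    exact ((leaves_caterpillar_perm k m).append_right l).trans
      ((List.perm_ext_iff_of_nodup nodup List.nodup_range').2 mem)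
  interval_cases r
  · exact ⟨caterpillar k 0, leaves_caterpillar_perm k 0, six_pow_le_faltCount_caterpillar k 0⟩
  · refine ⟨node (caterpillar k 1) (leaf 1), perm 1 _ [1] rfl ?_ fun a => ?_,
      one_leaf 1 one_pos⟩
    · simp [List.nodup_append, List.nodup_range', List.mem_range'_1]
      omega
    · simp [List.mem_range'_1]
      omega
  · refine ⟨node (caterpillar k 1) (node (leaf 1) (leaf (4 * k + 3))),
      perm 1 _ [1, 4 * k + 3] rfl ?_ fun a => ?_,
      (six_pow_le_faltCount_caterpillar k 1).trans
        (faltCount_le_faltCount_node (v := [1, 4 * k + 3]) (by simp [words]) ?_ fun x hx => ?_)⟩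
    · simp [List.nodup_append, List.nodup_range', List.mem_range'_1]
      omega
    · simp [List.mem_range'_1]
      omega
    · simp [bodd, Zig, Step]
    · rw [mem_leaves_caterpillar] at hx
      simp [bodd, Step]
      omega
  · refine ⟨node (node (caterpillar k 2) (leaf 1)) (node (leaf (4 * k + 4)) (leaf 2)),
      perm 2 _ [1, 4 * k + 4, 2] (by simp [leaves]) ?_ fun a => ?_,
      (one_leaf 2 two_pos).trans
        (faltCount_le_faltCount_node (v := [4 * k + 4, 2]) (by simp [words]) ?_ fun x hx => ?_)⟩
    · simp [List.nodup_append, List.nodup_range', List.mem_range'_1]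
      omega
    · simp [List.mem_range'_1]
      omega
    · simp [leaves, bodd, Zig, Step]
    · simp [leaves, mem_leaves_caterpillar] at hx
      simp [leaves, bodd, Step]
      omega

theorem rFAlt_bounds {n : ℕ} (hn : 0 < n) :
    6 ^ ((n - 1) / 4) ≤ rFAlt n ∧ (rFAlt n : ℝ) ≤ 6 ^ ((n : ℝ) / 4) := by
  have upper : ∀ t : BTree, t.leaves.Perm (List.range' 1 n) →
      (faltCount t : ℝ) ≤ 6 ^ ((n : ℝ) / 4) := fun t ht => by
    have := t.faltCount_le
    rwa [ht.length_eq, List.length_range'] at this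
  obtain ⟨t, ht, htn⟩ := exists_six_pow_le_faltCount hn
  have bdd : BddAbove {m | ∃ t : BTree, t.leaves.Perm (List.range' 1 n) ∧ m = faltCount t} := by
    refine ⟨⌊(6 : ℝ) ^ ((n : ℝ) / 4)⌋₊, ?_⟩
    rintro _ ⟨s, hs, rfl⟩
    exact Nat.le_floor (upper s hs)
  refine ⟨htn.trans (le_csSup bdd ⟨t, ht, rfl⟩), ?_⟩
  have mem := Nat.sSup_mem (s := {m | ∃ t : BTree, t.leaves.Perm (List.range' 1 n) ∧
    m = faltCount t}) ⟨_, t, ht, rfl⟩ bdd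
  obtain ⟨s, hs, h⟩ := mem
  rw [rFAlt, h]
  exact upper s hs

end BTree

/-- `(r_n^forw)^{1/n} → 6^{1/4}` as `n → ∞`. -/
theorem rFAlt_growth_rate :
    Filter.Tendsto (fun n : ℕ => (rFAlt n : ℝ) ^ ((n : ℝ)⁻¹)) Filter.atTop
      (nhds ((6 : ℝ) ^ ((1 : ℝ) / 4))) := by
  have six : (0 : ℝ) < 6 := by norm_num
  have lim : Filter.Tendsto (fun n : ℕ => (6 : ℝ) ^ (1 / 4 - (n : ℝ)⁻¹)) Filter.atTop
      (nhds ((6 : ℝ) ^ ((1 : ℝ) / 4))) := by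
    have : Filter.Tendsto (fun n : ℕ => (1 / 4 : ℝ) - (n : ℝ)⁻¹) Filter.atTop (nhds (1 / 4 - 0)) :=
      tendsto_const_nhds.sub tendsto_inv_atTop_nhds_zero_nat
    rw [sub_zero] at this
    exact ((Real.continuous_const_rpow six.ne').tendsto _).comp this
  refine tendsto_of_tendsto_of_tendsto_of_le_of_le' lim tendsto_const_nhds ?_ ?_ <;>
    filter_upwards [Filter.eventually_gt_atTop 0] with n hn
  all_goals
    obtain ⟨lower, upper⟩ := BTree.rFAlt_bounds hn
    have hn' : (0 : ℝ) < n := Nat.cast_pos.2 hn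
  · have exponent : (n : ℝ) / 4 - 1 ≤ ((n - 1) / 4 : ℕ) := by
      have : n ≤ 4 * ((n - 1) / 4) + 4 := by omega
      have : (n : ℝ) ≤ 4 * ((n - 1) / 4 : ℕ) + 4 := by exact_mod_cast this
      linarith
    have : (6 : ℝ) ^ ((n : ℝ) / 4 - 1) ≤ rFAlt n :=
      (Real.rpow_le_rpow_of_exponent_le (by norm_num) exponent).trans
        (by rw [Real.rpow_natCast]; exact_mod_cast lower)
    refine le_trans (le_of_eq ?_) (Real.rpow_le_rpow (by positivity) this (by positivity))
    rw [← Real.rpow_mul six.le]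
    congr 1
    field_simp
  · refine (Real.rpow_le_rpow (by positivity) upper (by positivity)).trans (le_of_eq ?_)
    rw [← Real.rpow_mul six.le]
    congr 1
    field_simp
end

section
/- (Combing out multiplicities.) Let T be a full binary tree with n leaves and ℓ any labeling of its leaves by positive integers (repetitions allowed). Then there exists a bijective labeling ℓ′ of the leaves of T by {1,…,n} such that the number of alternating words in W(T,ℓ) is at most the number of alternating words in W(T,ℓ′). Consequently, the supremum over all full binary trees T with n leaves and all (not necessarily injective) labelings ℓ of the number of alternating words in W(T,ℓ) equals r_n. -/
open scoped Classical

namespace BTree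

/-- Two trees have the same shape (so one is a relabeling of the other). -/
def sameShape : BTree → BTree → Prop
  | leaf _, leaf _ => True
  | node l r, node l' r' => l.sameShape l' ∧ r.sameShape r'
  | _, _ => False

end BTree

namespace BTree

/-- Relabel the leaves of a tree along a function. -/
def mapLeaves (g : ℕ → ℕ) : BTree → BTree
  | leaf a => leaf (g a)
  | node l r => node (l.mapLeaves g) (r.mapLeaves g)

theorem mapLeaves_sameShape (g : ℕ → ℕ) (t : BTree) : (t.mapLeaves g).sameShape t := by
  induction t with
  | leaf a => trivial
  | node l r hl hr => exact ⟨hl, hr⟩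

theorem words_mapLeaves (g : ℕ → ℕ) (t : BTree) :
    (t.mapLeaves g).words = t.words.image (List.map g) := by
  induction t with
  | leaf a => simp [mapLeaves, words]
  | node l r hl hr =>
    ext w
    simp only [mapLeaves, words, hl, hr, Finset.mem_union, Finset.mem_image, Finset.mem_product,
      Prod.exists]
    constructor
    · rintro (⟨_, _, ⟨⟨u, hu, rfl⟩, v, hv, rfl⟩, rfl⟩ | ⟨_, _, ⟨⟨u, hu, rfl⟩, v, hv, rfl⟩, rfl⟩)
      · exact ⟨u ++ v, Or.inl ⟨u, v, ⟨hu, hv⟩, rfl⟩, List.map_append⟩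
      · exact ⟨v ++ u, Or.inr ⟨u, v, ⟨hu, hv⟩, rfl⟩, List.map_append⟩
    · rintro ⟨_, ⟨u, v, ⟨hu, hv⟩, rfl⟩ | ⟨u, v, ⟨hu, hv⟩, rfl⟩, rfl⟩
      · exact Or.inl ⟨_, _, ⟨⟨u, hu, rfl⟩, v, hv, rfl⟩, List.map_append.symm⟩
      · exact Or.inr ⟨_, _, ⟨⟨u, hu, rfl⟩, v, hv, rfl⟩, List.map_append.symm⟩

/-- Labels may be lifted along `g` leaf by leaf. -/
theorem exists_mapLeaves_eq (g : ℕ → ℕ) (t : BTree) (L : List ℕ) (h : L.map g = t.leaves) :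
    ∃ t' : BTree, t'.leaves = L ∧ t'.mapLeaves g = t := by
  induction t generalizing L with
  | leaf a =>
    obtain ⟨b, rfl, rfl⟩ := List.map_eq_singleton_iff.mp h
    exact ⟨leaf b, rfl, rfl⟩
  | node l r hl hr =>
    obtain ⟨L₁, L₂, rfl, h₁, h₂⟩ := List.map_eq_append_iff.mp h
    obtain ⟨l', rfl, rfl⟩ := hl L₁ h₁
    obtain ⟨r', rfl, rfl⟩ := hr L₂ h₂
    exact ⟨node l' r', rfl, rfl⟩

theorem two_mul_card_words_le (t : BTree) : 2 * t.words.card ≤ 2 ^ t.leaves.length := by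
  induction t with
  | leaf a => simp [words, leaves]
  | node l r hl hr =>
    have h₁ : (node l r).words.card ≤ 2 * (l.words.card * r.words.card) := by
      rw [words, two_mul, ← Finset.card_product]
      exact (Finset.card_union_le _ _).trans
        (Nat.add_le_add Finset.card_image_le Finset.card_image_le)
    calc 2 * (node l r).words.card ≤ (2 * l.words.card) * (2 * r.words.card) := by linarith
      _ ≤ 2 ^ l.leaves.length * 2 ^ r.leaves.length := Nat.mul_le_mul hl hr
      _ = 2 ^ (node l r).leaves.length := by rw [leaves, List.length_append, pow_add]

end BTree

theorem altCount_le_two_pow (t : BTree) : altCount t ≤ 2 ^ t.leaves.length := by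
  have h₁ : altCount t ≤ t.words.card := Finset.card_filter_le _ _
  have h₂ := t.two_mul_card_words_le
  omega

/-- Alternation is reflected by monotone maps of the letters. -/
theorem IsAlternating.of_map {g : ℕ → ℕ} (hg : Monotone g) {w : List ℕ}
    (h : IsAlternating (w.map g)) : IsAlternating w := by
  have key : ∀ i, i < w.length → (w.map g).getD i 0 = g (w.getD i 0) := by
    intro i hi
    simp [List.getD_eq_getElem?_getD, hi]
  obtain ⟨hne, hbetween⟩ := h
  simp only [List.length_map] at hne hbetween
  have hlt : ∀ i j, i < w.length → j < w.length → w.getD i 0 < w.getD j 0 →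
      (w.map g).getD i 0 ≠ (w.map g).getD j 0 → (w.map g).getD i 0 < (w.map g).getD j 0 := by
    intro i j hi hj hij hne'
    refine lt_of_le_of_ne ?_ hne'
    rw [key i hi, key j hj]
    exact hg hij.le
  refine ⟨fun i hi heq => hne i hi ?_, fun i hi => ⟨fun hup => ?_, fun hdown => ?_⟩⟩
  · rw [key i (by omega), key (i + 1) hi, heq]
  · exact (hbetween i hi).1
      ⟨hlt _ _ (by omega) (by omega) hup.1 (hne i (by omega)),
        hlt _ _ (by omega) (by omega) hup.2 (hne (i + 1) (by omega))⟩
  · exact (hbetween i hi).2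
      ⟨hlt _ _ (by omega) (by omega) hdown.1 (hne (i + 1) (by omega)).symm,
        hlt _ _ (by omega) (by omega) hdown.2 (hne i (by omega)).symm⟩

theorem altCount_mapLeaves_le {g : ℕ → ℕ} (hg : Monotone g) (t : BTree) :
    altCount (t.mapLeaves g) ≤ altCount t := by
  refine (Finset.card_le_card ?_).trans
    (Finset.card_image_le (s := t.words.filter fun w => IsAlternating w) (f := List.map g))
  intro w hw
  rw [Finset.mem_filter, BTree.words_mapLeaves, Finset.mem_image] at hw
  obtain ⟨⟨u, hu, rfl⟩, halt⟩ := hw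
  exact Finset.mem_image_of_mem _ (Finset.mem_filter.mpr ⟨hu, halt.of_map hg⟩)

/-- Every list of naturals is, up to order, the image of `1, …, n` under a monotone map. -/
theorem exists_monotone_map_range'_perm (L : List ℕ) :
    ∃ g : ℕ → ℕ, Monotone g ∧ ((List.range' 1 L.length).map g).Perm L := by
  set s := L.mergeSort
  have hperm : s.Perm L := List.mergeSort_perm _ _
  have hsorted : s.SortedLE := List.sortedLE_mergeSort
  rw [← hperm.length_eq]
  refine ⟨fun i => s.getD (min (i - 1) (s.length - 1)) 0, fun i j hij => ?_, ?_⟩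
  · rcases Nat.eq_zero_or_pos s.length with h0 | hpos
    · simp [List.length_eq_zero_iff.mp h0]
    · have hi : min (i - 1) (s.length - 1) < s.length := by omega
      have hj : min (j - 1) (s.length - 1) < s.length := by omega
      simp only [List.getD_eq_getElem _ _ hi, List.getD_eq_getElem _ _ hj]
      exact hsorted.getElem_le_getElem_of_le (by omega)
  · refine .trans (.of_eq (List.ext_getElem (by simp) fun i h₁ h₂ => ?_)) hperm
    have hi : min i (s.length - 1) = i := by omega
    simp [hi, h₂]

theorem exists_bijective_labeling (t : BTree) :
    ∃ t' : BTree, t.sameShape t' ∧ t'.leaves.Perm (List.range' 1 t.leaves.length) ∧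
      altCount t ≤ altCount t' := by
  obtain ⟨g, hg, hperm⟩ := exists_monotone_map_range'_perm t.leaves
  obtain ⟨K, hmap, hK⟩ : ∃ K : List ℕ, t.leaves = K.map g ∧
      K.Perm (List.range' 1 t.leaves.length) :=
    (congrFun₂ (List.eq_map_comp_perm g) _ _).mpr hperm.symm
  obtain ⟨t', rfl, rfl⟩ := t.exists_mapLeaves_eq g K hmap.symm
  exact ⟨t', t'.mapLeaves_sameShape g, hK, altCount_mapLeaves_le hg t'⟩

/-- Combing out multiplicities: for any (possibly repeating) positive labeling of a full
binary tree with `n` leaves there is a bijective labeling by `{1,…,n}` of the same tree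
shape with at least as many alternating words; consequently the supremum over all
labelings equals `r_n`. -/
theorem combing_out (n : ℕ) :
    (∀ t : BTree, t.leaves.length = n → (∀ a ∈ t.leaves, 0 < a) →
      ∃ t' : BTree, t.sameShape t' ∧ t'.leaves.Perm (List.range' 1 n) ∧
        altCount t ≤ altCount t') ∧
    sSup {m | ∃ t : BTree, t.leaves.length = n ∧ (∀ a ∈ t.leaves, 0 < a) ∧
        m = altCount t} = rAlt n := by
  have hbdd : BddAbove {m | ∃ t : BTree, t.leaves.length = n ∧ (∀ a ∈ t.leaves, 0 < a) ∧
      m = altCount t} := by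
    refine ⟨2 ^ n, ?_⟩
    rintro _ ⟨t, rfl, -, rfl⟩
    exact altCount_le_two_pow t
  have hsub : {m | ∃ t : BTree, t.leaves.Perm (List.range' 1 n) ∧ m = altCount t} ⊆
      {m | ∃ t : BTree, t.leaves.length = n ∧ (∀ a ∈ t.leaves, 0 < a) ∧ m = altCount t} := by
    rintro _ ⟨t, ht, rfl⟩
    refine ⟨t, by simpa using ht.length_eq, fun a ha => ?_, rfl⟩
    have := List.mem_range'_1.mp (ht.mem_iff.mp ha)
    omega
  refine ⟨?_, le_antisymm (csSup_le' ?_) (csSup_le' fun m hm => le_csSup hbdd (hsub hm))⟩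
  · rintro t rfl -
    exact exists_bijective_labeling t
  · rintro _ ⟨t, rfl, -, rfl⟩
    obtain ⟨t', -, hperm, hle⟩ := exists_bijective_labeling t
    exact hle.trans (le_csSup (hbdd.mono hsub) ⟨t', hperm, rfl⟩)
end

section
/- (André's theorem.) For every real number x with |x| < π/2, the series Σ_{n=0}^∞ E_n x^n / n! converges and its sum equals tan x + 1/cos x, which in turn equals tan(x/2 + π/4). Here E_n is the number of forward alternating permutations of {1,…,n}. -/
open scoped Classical

open Equiv

/-- A permutation zigzags with phase `s` if it descends exactly at the positions of the same parity
as `s`. -/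
def IsZigzag (s : ℕ) {n : ℕ} (σ : Perm (Fin n)) : Prop :=
  ∀ i (h : i + 1 < n), σ ⟨i + 1, h⟩ < σ ⟨i, by omega⟩ ↔ Even (i + s)

/-- The number of zigzag permutations of `Fin (n + 1)` starting with a descent
and with first value `k`. -/
noncomputable def entringer (n k : ℕ) : ℕ :=
  Nat.card {σ : Perm (Fin (n + 1)) // IsZigzag 0 σ ∧ (σ 0 : ℕ) = k}

theorem isForwardAlternating_ofFn_iff {n : ℕ} (σ : Perm (Fin n)) :
    IsForwardAlternating (List.ofFn fun i => (σ i : ℕ)) ↔ IsZigzag 0 σ := by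
  have key (i : ℕ) (h : i < n) : (List.ofFn fun i => (σ i : ℕ)).getD i 0 = σ ⟨i, h⟩ := by
    simp [List.getD_eq_getElem?_getD, h]
  have hne (i : ℕ) (h : i + 1 < n) : (σ ⟨i, by omega⟩ : ℕ) ≠ σ ⟨i + 1, h⟩ := by
    intro he
    have := σ.injective (Fin.ext he)
    simp at this
  constructor
  · rintro ⟨⟨-, h₂⟩, h₃⟩ i
    induction i with
    | zero =>
      intro h
      rcases h₃ with h₃ | h₃
      · simp at h₃; omega
      · rw [key 0 (by omega), key 1 h] at h₃
        simpa using h₃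
    | succ i ih =>
      intro h
      have h₄ := h₂ i (by simpa using h)
      rw [key i (by omega), key (i + 1) (by omega), key (i + 1 + 1) h] at h₄
      have h₅ := ih (by omega)
      have h₆ := hne i (by omega)
      have h₇ := hne (i + 1) h
      rw [Fin.lt_def] at h₅ ⊢
      simp only [add_zero, Nat.even_add_one] at h₅ ⊢
      rw [← h₅]
      omega
  · intro hz
    refine ⟨⟨fun i hi => ?_, fun i hi => ?_⟩, ?_⟩
    · rw [List.length_ofFn] at hi
      rw [key i (by omega), key (i + 1) hi]
      exact hne i hi
    · rw [List.length_ofFn] at hi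
      rw [key i (by omega), key (i + 1) (by omega), key (i + 1 + 1) hi]
      have h₁ := hz i (by omega)
      have h₂ := hz (i + 1) hi
      rw [Fin.lt_def] at h₁ h₂
      simp only [add_zero, Nat.even_add_one] at h₁ h₂
      rw [← h₁] at h₂
      omega
    · rw [List.length_ofFn]
      rcases Nat.lt_or_ge 1 n with h | h
      · right
        rw [key 0 (by omega), key 1 h]
        simpa using hz 0 h
      · exact Or.inl h

theorem faltPerms_eq_card_isZigzag (n : ℕ) :
    faltPerms n = Nat.card {σ : Perm (Fin n) // IsZigzag 0 σ} := by
  simp only [faltPerms, isForwardAlternating_ofFn_iff]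

theorem isZigzag_revPerm_mul {s n : ℕ} (σ : Perm (Fin n)) :
    IsZigzag s (Fin.revPerm * σ) ↔ IsZigzag (s + 1) σ := by
  refine forall₂_congr fun i h => ?_
  have hne : σ ⟨i, by omega⟩ ≠ σ ⟨i + 1, h⟩ := by simp
  simp only [Perm.mul_apply, Fin.revPerm_apply, Fin.rev_lt_rev, ← add_assoc, Nat.even_add_one]
  grind

/-- The permutation with first value `p` whose other values are in the same relative order as those
of `τ`. -/
noncomputable def consPerm {n : ℕ} (p : Fin (n + 1)) (τ : Perm (Fin n)) : Perm (Fin (n + 1)) :=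
  Equiv.ofBijective (Fin.cons p fun i => p.succAbove (τ i)) <| Finite.injective_iff_bijective.1 <|
    Fin.cons_injective_iff.2
      ⟨by simp [Fin.succAbove_ne], Fin.succAbove_right_injective.comp τ.injective⟩

@[simp]
theorem consPerm_zero {n : ℕ} (p : Fin (n + 1)) (τ : Perm (Fin n)) : consPerm p τ 0 = p := rfl

@[simp]
theorem consPerm_succ {n : ℕ} (p : Fin (n + 1)) (τ : Perm (Fin n)) (i : Fin n) :
    consPerm p τ i.succ = p.succAbove (τ i) := rfl

theorem consPerm_injective {n : ℕ} (p : Fin (n + 1)) : Function.Injective (consPerm p) := by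
  intro τ τ' h
  ext i : 1
  have := DFunLike.congr_fun h i.succ
  simpa using this

theorem exists_consPerm_eq {n : ℕ} (σ : Perm (Fin (n + 1))) : ∃ τ, consPerm (σ 0) τ = σ := by
  have h (i : Fin n) : ∃ j, (σ 0).succAbove j = σ i.succ :=
    Fin.exists_succAbove_eq (by simp)
  choose f hf using h
  have hinj : Function.Injective f := fun i j hij => by
    simpa using (hf i).symm.trans ((congrArg _ hij).trans (hf j))
  refine ⟨Equiv.ofBijective f (Finite.injective_iff_bijective.1 hinj), ?_⟩
  ext i : 1
  cases i using Fin.cases with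
  | zero => simp
  | succ i => simp [hf]

theorem isZigzag_zero_consPerm_iff {n : ℕ} (p : Fin (n + 2)) (τ : Perm (Fin (n + 1))) :
    IsZigzag 0 (consPerm p τ) ↔ IsZigzag 1 τ ∧ (τ 0 : ℕ) < p := by
  have h₀ : consPerm p τ 1 < consPerm p τ 0 ↔ (τ 0 : ℕ) < p := by
    rw [← Fin.succ_zero_eq_one, consPerm_succ, consPerm_zero, Fin.succAbove_lt_iff_castSucc_lt,
      Fin.lt_def, Fin.val_castSucc]
  have hs (i : ℕ) (h : i + 1 < n + 1) :
      consPerm p τ ⟨i + 1 + 1, by omega⟩ < consPerm p τ ⟨i + 1, by omega⟩ ↔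
        τ ⟨i + 1, h⟩ < τ ⟨i, by omega⟩ :=
    Fin.succAbove_lt_succAbove_iff
  constructor
  · intro h
    exact ⟨fun i hi => by rw [← hs i hi, h (i + 1) (by omega), add_zero],
      h₀.1 ((h 0 (by omega)).2 (by simp))⟩
  · rintro ⟨h, hp⟩ (_ | i) hi
    · exact iff_of_true (h₀.2 hp) (by simp)
    · rw [hs i (by omega), h i (by omega), add_zero]

theorem entringer_succ_eq_card {n k : ℕ} (hk : k ≤ n + 1) :
    entringer (n + 1) k =
      Nat.card {τ : Perm (Fin (n + 1)) // IsZigzag 1 τ ∧ (τ 0 : ℕ) < k} := by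
  let p : Fin (n + 2) := ⟨k, by omega⟩
  symm
  refine Nat.card_eq_of_bijective
    (fun τ => ⟨consPerm p τ.1, (isZigzag_zero_consPerm_iff p τ.1).2 τ.2, rfl⟩) ⟨?_, ?_⟩
  · intro τ τ' h
    exact Subtype.ext (consPerm_injective p (congrArg Subtype.val h))
  · rintro ⟨σ, hσ, h₀⟩
    obtain ⟨τ, hτ⟩ := exists_consPerm_eq σ
    have hp : σ 0 = p := Fin.ext h₀
    rw [hp] at hτ
    subst hτ
    exact ⟨⟨τ, (isZigzag_zero_consPerm_iff p τ).1 hσ⟩, rfl⟩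

theorem card_isZigzag_one_apply_zero {n k : ℕ} (hk : k ≤ n) :
    Nat.card {τ : Perm (Fin (n + 1)) // IsZigzag 1 τ ∧ (τ 0 : ℕ) = k} = entringer n (n - k) := by
  refine Nat.card_congr ((Equiv.mulLeft Fin.revPerm).subtypeEquiv fun τ => ?_)
  rw [Equiv.coe_mulLeft, isZigzag_revPerm_mul]
  refine and_congr_right fun _ => ?_
  rw [Perm.mul_apply, Fin.revPerm_apply, Fin.val_rev]
  omega

theorem entringer_succ_succ {n k : ℕ} (hk : k ≤ n) :
    entringer (n + 1) (k + 1) = entringer (n + 1) k + entringer n (n - k) := by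
  rw [entringer_succ_eq_card (by omega), entringer_succ_eq_card (by omega),
    ← card_isZigzag_one_apply_zero hk, ← Nat.card_sum]
  have hd : Disjoint (fun τ : Perm (Fin (n + 1)) => IsZigzag 1 τ ∧ (τ 0 : ℕ) < k)
      (fun τ => IsZigzag 1 τ ∧ (τ 0 : ℕ) = k) := by
    rw [Pi.disjoint_iff]
    intro τ
    rw [Prop.disjoint_iff]
    grind
  refine Nat.card_congr (Equiv.trans (Equiv.subtypeEquivRight fun τ => ?_) (subtypeOrEquiv _ _ hd))
  grind

theorem entringer_succ_zero (n : ℕ) : entringer (n + 1) 0 = 0 := by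
  simp [entringer_succ_eq_card]

theorem entringer_self (n : ℕ) : entringer n n = faltPerms n := by
  rw [faltPerms_eq_card_isZigzag]
  cases n with
  | zero =>
    have : Subsingleton (Perm (Fin (0 + 1))) := inferInstanceAs (Subsingleton (Perm (Fin 1)))
    rw [entringer, Nat.card_eq_one_iff_unique.2 ⟨inferInstance, ⟨1, fun i h => by omega, rfl⟩⟩,
      Nat.card_eq_one_iff_unique.2 ⟨inferInstance, ⟨1, fun i h => by omega⟩⟩]
  | succ n =>
    rw [entringer_succ_eq_card le_rfl]
    refine Nat.card_congr ((Equiv.mulLeft Fin.revPerm).subtypeEquiv fun τ => ?_)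
    rw [Equiv.coe_mulLeft, isZigzag_revPerm_mul]
    exact and_iff_left (τ 0).is_lt

theorem faltPerms_zero : faltPerms 0 = 1 := by
  rw [faltPerms_eq_card_isZigzag, Nat.card_eq_one_iff_unique]
  exact ⟨inferInstance, ⟨1, fun i h => by omega⟩⟩

open Finset.HasAntidiagonal

theorem sub_mul_I_eq_sum_antidiagonal {c : ℕ → ℕ → ℂ}
    (hc : ∀ i j, c (i + 1) j = c i (j + 1) + c j i) (n j : ℕ) :
    c n j - c j n * Complex.I = ∑ p ∈ antidiagonal n,
      (n.choose p.1 : ℂ) * (Complex.I ^ p.1 * (c 0 (j + p.2) - c (j + p.2) 0 * Complex.I)) := by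
  induction n generalizing j with
  | zero => simp
  | succ n ih =>
    rw [Finset.sum_antidiagonal_choose_succ_mul
      (fun k m => Complex.I ^ k * (c 0 (j + m) - c (j + m) 0 * Complex.I))]
    have h₁ : c (n + 1) j - c j (n + 1) * Complex.I =
        (c n (j + 1) - c (j + 1) n * Complex.I) + Complex.I * (c n j - c j n * Complex.I) := by
      linear_combination hc n j + Complex.I * hc j n + c j n * Complex.I_sq
    rw [h₁, ih, ih, Finset.mul_sum]
    congr 1
    · simp only [add_assoc, add_comm 1]
    · refine Finset.sum_congr rfl fun p hp => ?_
      rw [mem_antidiagonal] at hp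
      rw [Nat.choose_symm_of_eq_add hp.symm]
      ring

theorem faltPerms_add_sum_antidiagonal (n : ℕ) :
    (faltPerms n : ℂ) + Complex.I * ∑ p ∈ antidiagonal n,
      (n.choose p.1 : ℂ) * (Complex.I ^ p.1 * faltPerms p.2) =
      Complex.I ^ n + if n = 0 then Complex.I else 0 := by
  have h₀ (m : ℕ) : (entringer m 0 : ℂ) = if m = 0 then 1 else 0 := by
    cases m with
    | zero => simp [entringer_self, faltPerms_zero]
    | succ m => simp [entringer_succ_zero]
  have h := sub_mul_I_eq_sum_antidiagonal (c := fun i j => (entringer (i + j) i : ℂ))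
    (fun i j => by
      have := entringer_succ_succ (n := i + j) (k := i) (by omega)
      rw [Nat.add_sub_cancel_left] at this
      rw [show i + 1 + j = i + j + 1 by ring, this, Nat.cast_add, add_comm j i, add_assoc]) n 0
  simp only [zero_add, add_zero, entringer_self, h₀] at h
  have hs : ∑ p ∈ antidiagonal n,
      (n.choose p.1 : ℂ) * (Complex.I ^ p.1 * if p.2 = 0 then 1 else 0) = Complex.I ^ n := by
    rw [Finset.sum_eq_single (n, 0)]
    · simp
    · rintro ⟨k, m⟩ hp hne
      rw [mem_antidiagonal] at hp
      have : m ≠ 0 := by rintro rfl; simp_all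
      simp [this]
    · simp
  have hmul : Complex.I * ∑ p ∈ antidiagonal n,
      (n.choose p.1 : ℂ) * (Complex.I ^ p.1 * faltPerms p.2) = ∑ p ∈ antidiagonal n,
      (n.choose p.1 : ℂ) * (Complex.I ^ p.1 * (faltPerms p.2 * Complex.I)) := by
    rw [Finset.mul_sum]
    exact Finset.sum_congr rfl fun p _ => by ring
  simp only [mul_sub, Finset.sum_sub_distrib, hs] at h
  rw [hmul]
  split_ifs at h ⊢ <;> linear_combination h

/-- The function `tan (z / 2 + π / 4)`, written in terms of `exp (I * z)`. -/
noncomputable def andreFun (z : ℂ) : ℂ :=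
  (Complex.exp (Complex.I * z) + Complex.I) / (1 + Complex.I * Complex.exp (Complex.I * z))

theorem one_add_I_mul_exp_ne_zero {z : ℂ} (hz : ‖z‖ < Real.pi / 2) :
    1 + Complex.I * Complex.exp (Complex.I * z) ≠ 0 := by
  intro h
  have h₁ : Complex.exp (Complex.I * z) = Complex.exp (Real.pi / 2 * Complex.I) := by
    rw [Complex.exp_pi_div_two_mul_I]
    linear_combination (-Complex.I) * h + Complex.exp (Complex.I * z) * Complex.I_sq
  obtain ⟨k, hk⟩ := Complex.exp_eq_exp_iff_exists_int.1 h₁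
  have h₂ : z = ((Real.pi / 2 + k * (2 * Real.pi) : ℝ) : ℂ) := by
    apply mul_left_cancel₀ Complex.I_ne_zero
    rw [hk]
    push_cast
    ring
  rw [h₂, Complex.norm_real, Real.norm_eq_abs, abs_lt] at hz
  have hπ := Real.pi_pos
  rcases le_or_gt 0 k with hk | hk
  · have : (0 : ℝ) ≤ k := by exact_mod_cast hk
    nlinarith
  · have : (k : ℝ) ≤ -1 := by exact_mod_cast Int.le_sub_one_of_lt hk
    nlinarith

theorem differentiableOn_andreFun :
    DifferentiableOn ℂ andreFun (Metric.ball 0 (Real.pi / 2)) := by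
  intro z hz
  refine DifferentiableAt.differentiableWithinAt ?_
  refine DifferentiableAt.div (by fun_prop) (by fun_prop) ?_
  exact one_add_I_mul_exp_ne_zero (mem_ball_zero_iff.1 hz)

theorem iteratedDeriv_andreFun_add_sum_antidiagonal (n : ℕ) :
    iteratedDeriv n andreFun 0 + Complex.I * ∑ p ∈ antidiagonal n,
      (n.choose p.1 : ℂ) * (Complex.I ^ p.1 * iteratedDeriv p.2 andreFun 0) =
      Complex.I ^ n + if n = 0 then Complex.I else 0 := by
  have hball : Metric.ball (0 : ℂ) (Real.pi / 2) ∈ nhds 0 :=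
    Metric.ball_mem_nhds _ (by positivity)
  have hF (m : ℕ) : ContDiffAt ℂ m andreFun 0 :=
    (differentiableOn_andreFun.analyticAt hball).contDiffAt
  have he (m : ℕ) : ContDiffAt ℂ m (fun z => Complex.exp (Complex.I * z)) 0 := by fun_prop
  have hfun : (fun z => andreFun z + Complex.I * (Complex.exp (Complex.I * z) * andreFun z))
      =ᶠ[nhds 0] fun z => Complex.exp (Complex.I * z) + Complex.I := by
    filter_upwards [hball] with z hz
    have hne := one_add_I_mul_exp_ne_zero (mem_ball_zero_iff.1 hz)
    rw [andreFun]
    field_simp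
  have h := hfun.iteratedDeriv_eq n
  rw [iteratedDeriv_fun_add (hF n) (by have := hF n; have := he n; fun_prop),
    iteratedDeriv_const_mul_field, iteratedDeriv_fun_mul (he n) (hF n),
    iteratedDeriv_fun_add (he n) contDiffAt_const, iteratedDeriv_const] at h
  simp only [iteratedDeriv_cexp_const_mul, mul_zero, Complex.exp_zero, mul_one] at h
  rw [← h, Finset.Nat.sum_antidiagonal_eq_sum_range_succ
    (fun k m => (n.choose k : ℂ) * (Complex.I ^ k * iteratedDeriv m andreFun 0))]
  simp only [mul_assoc]

theorem iteratedDeriv_andreFun (n : ℕ) : iteratedDeriv n andreFun 0 = faltPerms n := by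
  induction n using Nat.strong_induction_on with
  | _ n ih =>
    have h₁ := iteratedDeriv_andreFun_add_sum_antidiagonal n
    rw [← faltPerms_add_sum_antidiagonal n] at h₁
    have hmem : (0, n) ∈ antidiagonal n := by simp
    rw [← Finset.add_sum_erase _ _ hmem, ← Finset.add_sum_erase _ _ hmem,
      Finset.sum_congr rfl (g := fun p : ℕ × ℕ =>
        (n.choose p.1 : ℂ) * (Complex.I ^ p.1 * faltPerms p.2))] at h₁
    · have hI : (1 + Complex.I) ≠ 0 := fun h => by simpa using congrArg Complex.re h
      apply mul_left_cancel₀ hI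
      simp only [Nat.choose_zero_right, Nat.cast_one, pow_zero, one_mul] at h₁
      linear_combination h₁
    · rintro ⟨k, m⟩ hp
      rw [Finset.mem_erase, mem_antidiagonal, Ne, Prod.mk.injEq] at hp
      simp only
      rw [ih m (by omega)]

theorem hasSum_andreFun {z : ℂ} (hz : ‖z‖ < Real.pi / 2) :
    HasSum (fun n : ℕ => (faltPerms n : ℂ) * z ^ n / (Nat.factorial n)) (andreFun z) := by
  have h := Complex.hasSum_taylorSeries_on_ball differentiableOn_andreFun
    (mem_ball_zero_iff.2 hz)
  simpa only [iteratedDeriv_andreFun, sub_zero, smul_eq_mul, div_eq_inv_mul,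
    mul_comm (z ^ _)] using h

theorem andreFun_ofReal {x : ℝ} (hx : |x| < Real.pi / 2) :
    andreFun x = ((Real.tan x + 1 / Real.cos x : ℝ) : ℂ) := by
  have hcos : Complex.cos x ≠ 0 := by
    rw [← Complex.ofReal_cos]
    exact_mod_cast (Real.cos_pos_of_mem_Ioo (abs_lt.1 hx)).ne'
  have hne := one_add_I_mul_exp_ne_zero (z := x) (by simpa using hx)
  have hsc := Complex.sin_sq_add_cos_sq x
  rw [andreFun]
  rw [mul_comm Complex.I (x : ℂ), Complex.exp_mul_I] at hne ⊢
  rw [div_eq_iff hne]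
  push_cast
  rw [Complex.tan_eq_sin_div_cos]
  field_simp
  linear_combination hsc - Complex.sin x * (Complex.sin x + 1) * Complex.I_sq

theorem Real.tan_add_one_div_cos {x : ℝ} (hx : |x| < Real.pi / 2) :
    Real.tan x + 1 / Real.cos x = Real.tan (x / 2 + Real.pi / 4) := by
  set y := x / 2 + Real.pi / 4 with hy
  have hxy : x = 2 * y - Real.pi / 2 := by rw [hy]; ring
  obtain ⟨h₁, h₂⟩ := abs_lt.1 hx
  have hc : 0 < Real.cos y := Real.cos_pos_of_mem_Ioo ⟨by linarith, by linarith⟩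
  have hs : 0 < Real.sin y := Real.sin_pos_of_pos_of_lt_pi (by linarith) (by linarith)
  rw [Real.tan_eq_sin_div_cos, Real.tan_eq_sin_div_cos, hxy, Real.sin_sub_pi_div_two,
    Real.cos_sub_pi_div_two, Real.sin_two_mul, Real.cos_two_mul]
  field_simp
  linear_combination (-2) * Real.sin_sq_add_cos_sq y

/-- André's theorem: for `|x| < π/2`, the exponential generating function of the
forward alternating permutation counts `E_n` sums to `tan x + sec x = tan(x/2 + π/4)`. -/
theorem andre_theorem (x : ℝ) (hx : |x| < Real.pi / 2) :
    HasSum (fun n : ℕ => (faltPerms n : ℝ) * x ^ n / (Nat.factorial n))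
      (Real.tan x + 1 / Real.cos x) ∧
    Real.tan x + 1 / Real.cos x = Real.tan (x / 2 + Real.pi / 4) := by
  refine ⟨?_, Real.tan_add_one_div_cos hx⟩
  have h := hasSum_andreFun (z := x) (by simpa using hx)
  rw [andreFun_ofReal hx] at h
  exact Complex.hasSum_ofReal.1 (mod_cast h)
end

section
/- For every real number x with |x| < π/2, the series Σ_{n=0}^∞ Ẽ_n x^n / n! converges and its sum equals 2·tan(x/2 + π/4) − 1 − x, which also equals (2/cos x − 1) + (2·tan x − x). Here Ẽ_n is the number of alternating permutations of {1,…,n}. -/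
open scoped Classical

/-- A word is a zigzag for `r` if its consecutive entries are related alternately by `r` and by
the converse of `r`, starting with `r`. -/
def Zigzag {α : Type*} : (α → α → Prop) → List α → Prop
  | _, [] => True
  | _, [_] => True
  | r, a :: b :: l => r a b ∧ Zigzag (fun x y => r y x) (b :: l)

namespace Zigzag

variable {α : Type*} {r : α → α → Prop}

/-- A greatest entry of a zigzag word with at least two letters sits at an odd index, and splits
the word into two zigzag words. -/
theorem append_cons_iff (hr : ∀ x y, r x y → ¬ r y x) {m : α} {v : List α} (hv : ∀ x ∈ v, r x m) :
    ∀ u : List α, (∀ x ∈ u, r x m) → (Zigzag r (u ++ m :: v) ↔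
      (Odd u.length ∧ Zigzag r u ∧ Zigzag r v) ∨ (u = [] ∧ v = []))
  | [], _ => by
    cases v with
    | nil => simp [Zigzag]
    | cons c v => simp [Zigzag, hr _ _ (hv c (by simp))]
  | [a], hu => by
    have ham : r a m := hu a (by simp)
    cases v with
    | nil => simp [Zigzag, ham]
    | cons c v => simp [Zigzag, ham, hv c (by simp)]
  | [a, b], hu => by
    have hbm : ¬ r m b := hr _ _ (hu b (by simp))
    simp [Zigzag, hbm]
  | a :: b :: c :: u, hu => by
    have ih := append_cons_iff hr hv (c :: u) fun x hx => hu x (by simp_all)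
    simp only [List.cons_append] at ih
    simp only [List.cons_append, Zigzag, ih]
    simp [Nat.odd_add_one, parity_simps]
    tauto

end Zigzag

/-- The zigzag words for `r` that enumerate the finite set `S`. -/
noncomputable def zigzagWords {α : Type*} (r : α → α → Prop) (S : Finset α) : Finset (List α) :=
  S.val.lists.toFinset.filter (Zigzag r)

theorem mem_zigzagWords {α : Type*} {r : α → α → Prop} {S : Finset α} {w : List α} :
    w ∈ zigzagWords r S ↔ S.val = ↑w ∧ Zigzag r w := by
  simp [zigzagWords, Multiset.mem_lists_iff]

theorem zigzagWords_empty {α : Type*} (r : α → α → Prop) :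
    zigzagWords r ∅ = {[]} := by
  ext w
  rw [mem_zigzagWords]
  cases w <;> simp [Zigzag, eq_comm (a := (0 : Multiset α))]

theorem zigzagWords_singleton {α : Type*} {a : α} (r : α → α → Prop) :
    zigzagWords r {a} = {[a]} := by
  ext w
  rw [mem_zigzagWords, Finset.mem_singleton, Finset.singleton_val, eq_comm,
    Multiset.coe_eq_singleton]
  constructor
  · exact And.left
  · rintro rfl
    exact ⟨rfl, trivial⟩

/-- Splitting zigzag words at their greatest letter. -/
theorem card_zigzagWords_insert {α : Type*} [DecidableEq α] {r : α → α → Prop} (hr : ∀ x y, r x y → ¬ r y x)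
    {S : Finset α} {m : α} (hS : ∀ x ∈ S, r x m) :
    (zigzagWords r (insert m S)).card = (if S = ∅ then 1 else 0) +
      ∑ T ∈ S.powerset, if Odd T.card then
        (zigzagWords r T).card * (zigzagWords r (S \ T)).card else 0 := by
  have hm : m ∉ S := fun h => hr _ _ (hS m h) (hS m h)
  obtain rfl | hne := S.eq_empty_or_nonempty
  · simp [zigzagWords_singleton, zigzagWords_empty]
  rw [if_neg hne.ne_empty, zero_add, ← Finset.sum_filter]
  simp_rw [← Finset.card_product]
  rw [← Finset.card_sigma]
  symm
  refine Finset.card_bij (fun p _ => p.2.1 ++ m :: p.2.2) ?_ ?_ ?_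
  · rintro ⟨T, u, v⟩ h
    simp only [Finset.mem_sigma, Finset.mem_filter, Finset.mem_powerset, Finset.mem_product,
      mem_zigzagWords] at h
    obtain ⟨⟨hT, hodd⟩, ⟨hu, hzu⟩, hv, hzv⟩ := h
    have hu' : ∀ x ∈ u, r x m := fun x hx => hS x (hT (by
      rw [← Finset.mem_val, hu]; exact hx))
    have hv' : ∀ x ∈ v, r x m := fun x hx => hS x (Finset.sdiff_subset (s := S) (t := T) (by
      rw [← Finset.mem_val, hv]; exact hx))
    have hlen : u.length = T.card := by
      rw [← Multiset.coe_card, ← hu]; rfl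
    rw [mem_zigzagWords]
    refine ⟨?_, (Zigzag.append_cons_iff hr hv' u hu').2 (.inl ⟨hlen ▸ hodd, hzu, hzv⟩)⟩
    rw [Finset.insert_val_of_notMem hm, ← Multiset.coe_add, ← Multiset.cons_coe,
      Multiset.add_cons, ← hu, ← hv, Finset.sdiff_val, add_tsub_cancel_of_le]
    exact Finset.val_le_iff.2 hT
  · rintro ⟨T, u, v⟩ h ⟨T', u', v'⟩ h' heq
    simp only [Finset.mem_sigma, Finset.mem_filter, Finset.mem_powerset, Finset.mem_product,
      mem_zigzagWords] at h h'
    obtain ⟨⟨hT, -⟩, ⟨hu, -⟩, hv, -⟩ := h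
    obtain ⟨-, ⟨hu', -⟩, -⟩ := h'
    have hmu : m ∉ u := fun hx => hm (hT (by rw [← Finset.mem_val, hu]; exact hx))
    have hmv : m ∉ v := fun hx => hm (Finset.sdiff_subset (s := S) (t := T) (by
      rw [← Finset.mem_val, hv]; exact hx))
    obtain ⟨rfl, -, rfl⟩ := (List.append_cons_inj_of_notMem hmu hmv).1 heq
    obtain rfl : T = T' := Finset.val_injective (hu.trans hu'.symm)
    rfl
  · intro w hw
    rw [mem_zigzagWords] at hw
    obtain ⟨hw, hz⟩ := hw
    have hmw : m ∈ w := by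
      rw [← Multiset.mem_coe, ← hw]; simp
    obtain ⟨u, v, rfl⟩ := List.append_of_mem hmw
    have hval : S.val = ↑u + (↑v : Multiset α) := by
      rw [Finset.insert_val_of_notMem hm, ← Multiset.coe_add, ← Multiset.cons_coe,
        Multiset.add_cons] at hw
      exact (Multiset.cons_inj_right m).1 hw
    have hnd : (↑u + (↑v : Multiset α)).Nodup := hval ▸ S.nodup
    have hu : ∀ x ∈ u, r x m := fun x hx => hS x (by rw [← Finset.mem_val, hval]; simp [hx])
    have hv : ∀ x ∈ v, r x m := fun x hx => hS x (by rw [← Finset.mem_val, hval]; simp [hx])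
    have hlen : S.card = u.length + v.length := by
      rw [Finset.card_def, hval]; simp
    rw [Zigzag.append_cons_iff hr hv u hu] at hz
    obtain ⟨hodd, hzu, hzv⟩ | ⟨rfl, rfl⟩ := hz
    · have hundup : (↑u : Multiset α).Nodup := (Multiset.nodup_add.1 hnd).1
      refine ⟨⟨⟨↑u, hundup⟩, u, v⟩, ?_, rfl⟩
      simp only [Finset.mem_sigma, Finset.mem_filter, Finset.mem_powerset, Finset.mem_product,
        mem_zigzagWords]
      refine ⟨⟨?_, ?_⟩, ⟨?_, hzu⟩, ?_, hzv⟩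
      · rw [← Finset.val_le_iff, hval]
        exact Multiset.le_add_right _ _
      · simpa using hodd
      · trivial
      · rw [Finset.sdiff_val, hval]
        exact add_tsub_cancel_left _ _
    · simp at hlen
      exact absurd hlen hne.ne_empty

theorem isAlternating_cons_cons_cons {a b c : ℕ} {l : List ℕ} :
    IsAlternating (a :: b :: c :: l) ↔
      ((a < b ∧ c < b) ∨ (b < a ∧ b < c)) ∧ IsAlternating (b :: c :: l) := by
  constructor
  · rintro ⟨h₁, h₂⟩
    refine ⟨?_, fun i hi => ?_, fun i hi => ?_⟩
    · have h₀ := h₁ 0 (by simp)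
      have h₁ := h₁ 1 (by simp)
      have h₂ := h₂ 0 (by simp)
      simp only [List.getD_cons_zero, List.getD_cons_succ, zero_add] at h₀ h₁ h₂
      omega
    · exact h₁ (i + 1) (Nat.succ_lt_succ hi)
    · exact h₂ (i + 1) (Nat.succ_lt_succ hi)
  · rintro ⟨h, h₁, h₂⟩
    refine ⟨fun i hi => ?_, fun i hi => ?_⟩
    · cases i with
      | zero =>
        simp only [List.getD_cons_zero, List.getD_cons_succ, zero_add]
        omega
      | succ i => exact h₁ i (Nat.lt_of_succ_lt_succ hi)
    · cases i with
      | zero =>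
        simp only [List.getD_cons_zero, List.getD_cons_succ, zero_add]
        omega
      | succ i => exact h₂ i (Nat.lt_of_succ_lt_succ hi)

theorem isAlternating_iff_zigzag :
    ∀ w : List ℕ, IsAlternating w ↔ Zigzag (· < ·) w ∨ Zigzag (· > ·) w
  | [] => by simp [IsAlternating, Zigzag]
  | [a] => by simp [IsAlternating, Zigzag]
  | [a, b] => by
    simp [IsAlternating, Zigzag]
  | a :: b :: c :: l => by
    rw [isAlternating_cons_cons_cons, isAlternating_iff_zigzag (b :: c :: l)]
    simp only [Zigzag, gt_iff_lt]
    constructor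
    · rintro ⟨h | h, h' | h'⟩ <;> grind
    · grind

theorem altPerms_eq_card (n : ℕ) :
    altPerms n = ((Finset.range n).val.lists.toFinset.filter IsAlternating).card := by
  rw [altPerms, Nat.card_eq_fintype_card, Fintype.card_subtype]
  refine Finset.card_bij (fun σ _ => List.ofFn fun i => (σ i : ℕ)) ?_ ?_ ?_
  · intro σ hσ
    rw [Finset.mem_filter] at hσ ⊢
    refine ⟨?_, hσ.2⟩
    rw [Multiset.mem_toFinset, Multiset.mem_lists_iff, Finset.range_val, Multiset.range,
      Multiset.quot_mk_to_coe, Multiset.coe_eq_coe, ← List.map_coe_finRange_eq_range,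
      List.ofFn_eq_map]
    exact ((Equiv.Perm.map_finRange_perm σ).map Fin.val).symm.trans (by simp [Function.comp_def])
  · intro σ _ τ _ h
    exact Equiv.ext fun i => Fin.ext (congrFun (List.ofFn_injective h) i)
  · intro w hw
    rw [Finset.mem_filter, Multiset.mem_toFinset, Multiset.mem_lists_iff, Finset.range_val,
      Multiset.range, Multiset.quot_mk_to_coe, Multiset.coe_eq_coe] at hw
    obtain ⟨hperm, halt⟩ := hw
    obtain rfl : n = w.length := by simpa using hperm.length_eq
    have hlt : ∀ i : Fin w.length, w[i] < w.length := fun i =>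
      List.mem_range.1 (hperm.mem_iff.2 (List.getElem_mem i.2))
    have hnd : w.Nodup := hperm.nodup_iff.1 List.nodup_range
    have hinj : Function.Injective fun i : Fin w.length => (⟨w[i], hlt i⟩ : Fin w.length) := by
      intro i j hij
      exact Fin.ext ((hnd.getElem_inj_iff).1 (Fin.ext_iff.1 hij))
    have hofFn : (List.ofFn fun i => (Equiv.ofBijective _ hinj.bijective_of_finite i : ℕ)) = w := by
      simp
    exact ⟨Equiv.ofBijective _ hinj.bijective_of_finite,
      Finset.mem_filter.2 ⟨Finset.mem_univ _, hofFn.symm ▸ halt⟩, hofFn⟩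

theorem altPerms_add (n : ℕ) :
    altPerms n + (if n ≤ 1 then 1 else 0) =
      (zigzagWords (· < ·) (Finset.range n)).card + (zigzagWords (· > ·) (Finset.range n)).card := by
  rw [altPerms_eq_card, ← Finset.card_union_add_card_inter]
  congr 1
  · congr 1
    ext w
    simp only [zigzagWords, Finset.mem_union, Finset.mem_filter, Multiset.mem_toFinset,
      isAlternating_iff_zigzag, and_or_left]
  · split_ifs with hn
    · interval_cases n
      · simp [zigzagWords_empty]
      · simp [zigzagWords_singleton]
    · symm
      rw [Finset.card_eq_zero, Finset.eq_empty_iff_forall_notMem]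
      intro w hw
      rw [Finset.mem_inter, mem_zigzagWords, mem_zigzagWords] at hw
      obtain ⟨⟨hw, h₁⟩, -, h₂⟩ := hw
      have hlen : n = w.length := by simpa using congrArg Multiset.card hw
      match w with
      | [] => simp at hlen; omega
      | [_] => simp at hlen; omega
      | a :: b :: l => exact lt_asymm h₁.1 h₂.1

open Complex in
theorem Complex.cos_ne_zero_of_norm_lt {z : ℂ} (hz : ‖z‖ < Real.pi / 2) : cos z ≠ 0 := by
  rw [Ne, cos_eq_zero_iff]
  rintro ⟨k, rfl⟩
  have hk : (1 : ℝ) ≤ |2 * (k : ℝ) + 1| := by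
    have : (1 : ℤ) ≤ |2 * k + 1| := Int.one_le_abs (by omega)
    exact_mod_cast this
  have hnorm : ‖(2 * (k : ℂ) + 1) * Real.pi / 2‖ = |2 * (k : ℝ) + 1| * (Real.pi / 2) := by
    have : (2 * (k : ℂ) + 1) * Real.pi / 2 = (((2 * (k : ℝ) + 1) * (Real.pi / 2) : ℝ) : ℂ) := by
      push_cast
      ring
    rw [this, norm_real, Real.norm_eq_abs, abs_mul, abs_of_pos Real.pi_div_two_pos]
  rw [hnorm] at hz
  nlinarith [Real.pi_pos]

/-- The complex function `tan + sec`. -/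
noncomputable def tanAddSec (z : ℂ) : ℂ := Complex.tan z + 1 / Complex.cos z

theorem contDiffAt_tanAddSec {z : ℂ} (hz : Complex.cos z ≠ 0) (n : WithTop ℕ∞) :
    ContDiffAt ℂ n tanAddSec z :=
  (Complex.contDiffAt_tan.2 hz).add (contDiffAt_const.div Complex.contDiff_cos.contDiffAt hz)

theorem deriv_tanAddSec {z : ℂ} (hz : Complex.cos z ≠ 0) :
    deriv tanAddSec z = 1 + Complex.tan z * tanAddSec z := by
  have h := (Complex.hasDerivAt_tan hz).add
    ((hasDerivAt_const z (1 : ℂ)).div (Complex.hasDerivAt_cos z) hz)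
  have h' : HasDerivAt tanAddSec _ z := h
  rw [h'.deriv, tanAddSec, Complex.tan_eq_sin_div_cos]
  field_simp
  linear_combination -(Complex.sin_sq_add_cos_sq z)

theorem iteratedDeriv_tan_zero (n : ℕ) :
    iteratedDeriv n Complex.tan 0 = if Odd n then iteratedDeriv n tanAddSec 0 else 0 := by
  have hF : ContDiffAt ℂ n tanAddSec 0 := contDiffAt_tanAddSec (by simp) n
  have hF' : ContDiffAt ℂ n (fun z => tanAddSec (-z)) 0 :=
    ContDiffAt.comp (g := tanAddSec) (0 : ℂ) (by simpa using hF) contDiff_neg.contDiffAt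
  have htan : (fun z => 2 * Complex.tan z) = fun z => tanAddSec z - tanAddSec (-z) := by
    funext z
    simp only [tanAddSec, Complex.tan_neg, Complex.cos_neg]
    ring
  have h : 2 * iteratedDeriv n Complex.tan 0 =
      iteratedDeriv n tanAddSec 0 - (-1) ^ n * iteratedDeriv n tanAddSec 0 := by
    rw [← iteratedDeriv_const_mul_field, htan, iteratedDeriv_fun_sub hF hF',
      iteratedDeriv_comp_neg, neg_zero, smul_eq_mul]
  split_ifs with hn
  · rw [hn.neg_one_pow] at h
    linear_combination h / 2
  · rw [(Nat.not_odd_iff_even.1 hn).neg_one_pow] at h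
    linear_combination h / 2

theorem iteratedDeriv_succ_tanAddSec_zero (n : ℕ) :
    iteratedDeriv (n + 1) tanAddSec 0 = (if n = 0 then 1 else 0) +
      ∑ k ∈ Finset.range (n + 1), n.choose k *
        if Odd k then iteratedDeriv k tanAddSec 0 * iteratedDeriv (n - k) tanAddSec 0 else 0 := by
  have hcos : ∀ᶠ z in nhds (0 : ℂ), Complex.cos z ≠ 0 :=
    Complex.continuous_cos.continuousAt.eventually_ne (by simp)
  have hderiv : deriv tanAddSec =ᶠ[nhds 0] fun z => 1 + (Complex.tan * tanAddSec) z :=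
    hcos.mono fun z hz => deriv_tanAddSec hz
  have htan : ContDiffAt ℂ n Complex.tan 0 := Complex.contDiffAt_tan.2 (by simp)
  have hF : ContDiffAt ℂ n tanAddSec 0 := contDiffAt_tanAddSec (by simp) n
  rw [iteratedDeriv_succ', hderiv.iteratedDeriv_eq, iteratedDeriv_fun_add
    (g := Complex.tan * tanAddSec) contDiffAt_const (htan.mul hF), iteratedDeriv_const, iteratedDeriv_mul htan hF]
  congr 1
  refine Finset.sum_congr rfl fun k _ => ?_
  rw [iteratedDeriv_tan_zero]
  split_ifs <;> ring

/-- The number of zigzag enumerations of a finite set whose nonempty subsets have greatest elements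
is a Taylor coefficient of `tan + sec`. -/
theorem card_zigzagWords {α : Type*} {r : α → α → Prop} (hr : ∀ x y, r x y → ¬ r y x)
    (hmax : ∀ S : Finset α, S.Nonempty → ∃ m ∈ S, ∀ x ∈ S, x ≠ m → r x m) (S : Finset α) :
    ((zigzagWords r S).card : ℂ) = iteratedDeriv S.card tanAddSec 0 := by
  induction S using Finset.strongInduction with
  | H S ih =>
    obtain rfl | hS := S.eq_empty_or_nonempty
    · simp [zigzagWords_empty, tanAddSec]
    obtain ⟨m, hm, hmS⟩ := hmax S hS
    obtain ⟨T, hT, rfl⟩ : ∃ T, m ∉ T ∧ insert m T = S :=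
      ⟨S.erase m, Finset.notMem_erase m S, Finset.insert_erase hm⟩
    have hTm : ∀ x ∈ T, r x m := fun x hx =>
      hmS x (Finset.mem_insert_of_mem hx) fun h => hT (h ▸ hx)
    have hsub : ∀ U ⊆ T, U ⊂ insert m T := fun U hU =>
      (hU.trans_ssubset (Finset.ssubset_insert hT))
    rw [card_zigzagWords_insert hr hTm, Finset.card_insert_of_notMem hT,
      iteratedDeriv_succ_tanAddSec_zero]
    push_cast
    simp only [Finset.card_eq_zero]
    congr 1
    simp only [← nsmul_eq_mul (n := Nat.choose _ _)]
    rw [← Finset.sum_powerset_apply_card (fun k => if Odd k then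
      iteratedDeriv k tanAddSec 0 * iteratedDeriv (T.card - k) tanAddSec 0 else 0)]
    refine Finset.sum_congr rfl fun U hU => ?_
    rw [Finset.mem_powerset] at hU
    rw [ih U (hsub U hU), ih (T \ U) (hsub _ Finset.sdiff_subset),
      Finset.card_sdiff_of_subset hU]

theorem altPerms_eq_iteratedDeriv (n : ℕ) :
    (altPerms n : ℂ) = 2 * iteratedDeriv n tanAddSec 0 - if n ≤ 1 then 1 else 0 := by
  have h := congrArg (Nat.cast (R := ℂ)) (altPerms_add n)
  push_cast at h
  rw [card_zigzagWords (fun _ _ => lt_asymm) (fun S hS => ⟨S.max' hS, S.max'_mem hS,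
      fun x hx hne => lt_of_le_of_ne (S.le_max' x hx) hne⟩),
    card_zigzagWords (fun _ _ => lt_asymm) (fun S hS => ⟨S.min' hS, S.min'_mem hS,
      fun x hx hne => lt_of_le_of_ne (S.min'_le x hx) hne.symm⟩), Finset.card_range] at h
  linear_combination h

theorem hasSum_tanAddSec {z : ℂ} (hz : ‖z‖ < Real.pi / 2) :
    HasSum (fun n : ℕ => iteratedDeriv n tanAddSec 0 * z ^ n / n.factorial) (tanAddSec z) := by
  have hd : DifferentiableOn ℂ tanAddSec (Metric.ball 0 (Real.pi / 2)) := fun w hw =>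
    ((contDiffAt_tanAddSec (Complex.cos_ne_zero_of_norm_lt (mem_ball_zero_iff.1 hw))
      1).differentiableAt one_ne_zero).differentiableWithinAt
  refine (Complex.hasSum_taylorSeries_on_ball hd (mem_ball_zero_iff.2 hz)).congr_fun fun n => ?_
  simp only [sub_zero, smul_eq_mul]
  ring

theorem hasSum_altPerms {z : ℂ} (hz : ‖z‖ < Real.pi / 2) :
    HasSum (fun n : ℕ => (altPerms n : ℂ) * z ^ n / n.factorial)
      (2 * tanAddSec z - (1 + z)) := by
  have h : HasSum (fun n : ℕ => if n ≤ 1 then z ^ n / n.factorial else 0) (1 + z) := by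
    have h := hasSum_sum_of_ne_finset_zero (L := .unconditional ℕ) (s := Finset.range 2)
      (f := fun n : ℕ => if n ≤ 1 then z ^ n / n.factorial else 0) fun n hn =>
        if_neg fun h => hn (Finset.mem_range.2 (Nat.lt_succ_of_le h))
    simpa [Finset.sum_range_succ] using h
  refine (((hasSum_tanAddSec hz).mul_left 2).sub h).congr_fun fun n => ?_
  rw [altPerms_eq_iteratedDeriv]
  split_ifs <;> ring

theorem Real.tan_div_two_add_pi_div_four {x : ℝ} (hx : |x| < Real.pi / 2) :
    Real.tan (x / 2 + Real.pi / 4) = 1 / Real.cos x + Real.tan x := by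
  obtain ⟨h₁, h₂⟩ := abs_lt.1 hx
  have hcos : 0 < Real.cos x := Real.cos_pos_of_mem_Ioo ⟨h₁, h₂⟩
  have hcos' : 0 < Real.cos (x / 2 + Real.pi / 4) :=
    Real.cos_pos_of_mem_Ioo ⟨by linarith, by linarith⟩
  have hs : Real.sin x = 2 * Real.sin (x / 2) * Real.cos (x / 2) := by
    rw [← Real.sin_two_mul]; congr 1; ring
  have hc : Real.cos x = Real.cos (x / 2) ^ 2 - Real.sin (x / 2) ^ 2 := by
    rw [← Real.cos_two_mul']; congr 1; ring
  have hq := Real.sin_sq_add_cos_sq (x / 2)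
  rw [Real.tan_eq_sin_div_cos, Real.tan_eq_sin_div_cos, ← add_div, div_eq_div_iff hcos'.ne' hcos.ne',
    Real.sin_add, Real.cos_add, Real.cos_pi_div_four, Real.sin_pi_div_four, hs, hc]
  linear_combination (√2 / 2 * (Real.cos (x / 2) - Real.sin (x / 2))) * hq

/-- For `|x| < π/2`, the exponential generating function of the alternating permutation
counts `Ẽ_n` sums to `2 tan(x/2 + π/4) - 1 - x = (2 sec x - 1) + (2 tan x - x)`. -/
theorem altPerms_egf (x : ℝ) (hx : |x| < Real.pi / 2) :
    HasSum (fun n : ℕ => (altPerms n : ℝ) * x ^ n / (Nat.factorial n))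
      (2 * Real.tan (x / 2 + Real.pi / 4) - 1 - x) ∧
    2 * Real.tan (x / 2 + Real.pi / 4) - 1 - x =
      (2 / Real.cos x - 1) + (2 * Real.tan x - x) := by
  rw [Real.tan_div_two_add_pi_div_four hx]
  refine ⟨?_, by ring⟩
  rw [← Complex.hasSum_ofReal]
  convert hasSum_altPerms (z := x) (by simpa using hx) using 1
  · push_cast
    rfl
  · rw [tanAddSec]
    push_cast
    ring
end
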